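/- (Finite λ-lemma) Let a₁, …, a_{n+1} ∈ ℂ̂ be pairwise distinct points, and let f : Δ × {a₁, …, a_n} → ℂ̂ be a holomorphic motion. Then there exists a holomorphic motion f̃ : Δ × {a₁, …, a_{n+1}} → ℂ̂ such that f̃(λ, a_i) = f(λ, a_i) for all λ ∈ Δ and i = 1, …, n. -/

import Mathlib

open Set Metric Complex

noncomputable section

/-- The antiholomorphic involution `z ↦ 1/z` on the Riemann sphere `ℂ̂ = OnePoint ℂ`. -/
def sphereInv (p : OnePoint ℂ) : OnePoint ℂ :=
  Option.elim p ((0 : ℂ) : OnePoint ℂ)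
    (fun z => if z = 0 then OnePoint.infty else ((z⁻¹ : ℂ) : OnePoint ℂ))

/-- A sphere-valued function is holomorphic on `s` if near every point it is, in one of the two
standard charts on `ℂ̂`, given by an analytic ℂ-valued function. -/
def HolomorphicOnSphere (u : ℂ → OnePoint ℂ) (s : Set ℂ) : Prop :=
  ∀ z ∈ s, ∃ v : ℂ → ℂ, AnalyticAt ℂ v z ∧
    ((∀ᶠ w in nhds z, u w = ((v w : ℂ) : OnePoint ℂ)) ∨
     (∀ᶠ w in nhds z, sphereInv (u w) = ((v w : ℂ) : OnePoint ℂ)))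

/-- A holomorphic motion of `A ⊆ ℂ̂` over the unit disk `Δ`: holomorphic in `λ`,
injective in `a` for each fixed `λ`, and the identity at `λ = 0`. -/
def IsHolomorphicMotion (A : Set (OnePoint ℂ)) (f : ℂ → OnePoint ℂ → OnePoint ℂ) : Prop :=
  (∀ a ∈ A, HolomorphicOnSphere (fun l => f l a) (ball (0 : ℂ) 1)) ∧
  (∀ l ∈ ball (0 : ℂ) 1, Set.InjOn (f l) A) ∧
  (∀ a ∈ A, f 0 a = a)

section CauchyTransform
open MeasureTheory Filter Topology

/-- Lebesgue measure on the annulus `1 ≤ ‖z‖ ≤ e`. -/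
def annulusMeasure : Measure ℂ := volume.restrict (closedBall 0 (Real.exp 1) \ ball 0 1)

instance : IsFiniteMeasure annulusMeasure :=
  isFiniteMeasure_restrict.2
    ((measure_mono sdiff_subset).trans_lt measure_closedBall_lt_top).ne

instance : NullSingletonClass annulusMeasure := by
  unfold annulusMeasure; infer_instance

lemma lintegral_enorm_inv_ball_le (ε : ℝ) :
    ∫⁻ ζ in ball (0 : ℂ) ε, ‖ζ⁻¹‖ₑ ≤ ENNReal.ofReal (2 * Real.pi * ε) := by
  rw [← lintegral_indicator measurableSet_ball, ← Complex.lintegral_comp_polarCoord_symm]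
  have h : ∀ p ∈ polarCoord.target, ENNReal.ofReal p.1 •
      (ball (0 : ℂ) ε).indicator (fun ζ => ‖ζ⁻¹‖ₑ) (Complex.polarCoord.symm p) =
      (Ioo 0 ε ×ˢ Ioo (-Real.pi) Real.pi).indicator 1 p := by
    rintro ⟨s, θ⟩ hp
    simp only [polarCoord_target, mem_prod, mem_Ioi] at hp
    have hn : ‖Complex.polarCoord.symm (s, θ)‖ = s := by
      rw [Complex.norm_polarCoord_symm, abs_of_pos hp.1]
    by_cases hs : s < ε
    · have hmem : (s, θ) ∈ Ioo 0 ε ×ˢ Ioo (-Real.pi) Real.pi := ⟨⟨hp.1, hs⟩, hp.2⟩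
      rw [indicator_of_mem (mem_ball_zero_iff.2 (hn.trans_lt hs)), indicator_of_mem hmem]
      rw [← ofReal_norm, norm_inv, hn, smul_eq_mul, ← ENNReal.ofReal_mul hp.1.le,
        mul_inv_cancel₀ hp.1.ne']
      simp
    · rw [indicator_of_notMem (fun h => hs (hn ▸ mem_ball_zero_iff.1 h)), indicator_of_notMem]
      · simp
      · rintro ⟨h1, h2⟩; exact hs h1.2
  rw [setLIntegral_congr_fun (polarCoord.open_target.measurableSet) h]
  refine (setLIntegral_le_lintegral _ _).trans ?_
  rw [lintegral_indicator_one (measurableSet_Ioo.prod measurableSet_Ioo),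
    Measure.volume_eq_prod, Measure.prod_prod, Real.volume_Ioo, Real.volume_Ioo]
  rcases le_or_gt ε 0 with h0 | h0
  · rw [ENNReal.ofReal_of_nonpos (by linarith)]; simp
  · rw [← ENNReal.ofReal_mul (by linarith)]
    apply ENNReal.ofReal_le_ofReal
    nlinarith

lemma lintegral_enorm_inv_sub_ball_le (z : ℂ) (ε : ℝ) :
    ∫⁻ ζ in ball z ε, ‖(z - ζ)⁻¹‖ₑ ≤ ENNReal.ofReal (2 * Real.pi * ε) := by
  refine le_trans (le_of_eq ?_) (lintegral_enorm_inv_ball_le ε)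
  rw [← lintegral_indicator measurableSet_ball, ← lintegral_indicator measurableSet_ball,
    ← lintegral_sub_left_eq_self _ z]
  congr 1 with ζ
  simp [indicator, dist_eq_norm]

/-- A bound for the `L¹`-norms of all the Cauchy kernels over the annulus. -/
def kernelBound : ℝ := 2 * Real.pi + annulusMeasure.real univ

lemma kernelBound_nonneg : 0 ≤ kernelBound := by unfold kernelBound; positivity

lemma lintegral_cauchyKernel_le (z : ℂ) :
    ∫⁻ ζ, ‖(z - ζ)⁻¹‖ₑ ∂annulusMeasure ≤ ENNReal.ofReal kernelBound := by
  rw [← lintegral_add_compl _ (measurableSet_ball (x := z) (ε := 1)), kernelBound,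
    ENNReal.ofReal_add (by positivity) (by positivity)]
  refine add_le_add ?_ ?_
  · have := lintegral_enorm_inv_sub_ball_le z 1
    rw [mul_one] at this
    refine le_trans (lintegral_mono' (Measure.restrict_mono le_rfl ?_) le_rfl) this
    exact Measure.restrict_le_self
  · calc ∫⁻ ζ in (ball z 1)ᶜ, ‖(z - ζ)⁻¹‖ₑ ∂annulusMeasure
        ≤ ∫⁻ ζ in (ball z 1)ᶜ, 1 ∂annulusMeasure := by
          refine setLIntegral_mono measurable_one fun ζ hζ => ?_
          rw [← ofReal_norm, norm_inv]
          rw [← ENNReal.ofReal_one]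
          apply ENNReal.ofReal_le_ofReal
          apply inv_le_one_of_one_le₀
          simpa [dist_eq_norm, norm_sub_rev] using hζ
      _ ≤ ∫⁻ ζ, 1 ∂annulusMeasure := setLIntegral_le_lintegral _ _
      _ = _ := by simp

lemma integrable_cauchyKernel (z : ℂ) : Integrable (fun ζ => (z - ζ)⁻¹) annulusMeasure :=
  ⟨by fun_prop, (lintegral_cauchyKernel_le z).trans_lt ENNReal.ofReal_lt_top⟩

lemma integral_norm_cauchyKernel_le (z : ℂ) :
    ∫ ζ, ‖(z - ζ)⁻¹‖ ∂annulusMeasure ≤ kernelBound := by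
  rw [integral_norm_eq_lintegral_enorm (by fun_prop)]
  exact ENNReal.toReal_le_of_le_ofReal kernelBound_nonneg (lintegral_cauchyKernel_le z)

/-- The Cauchy transform of `a` with respect to `annulusMeasure`. -/
def cauchyTransform (a : ℂ → ℂ) (z : ℂ) : ℂ := ∫ ζ, a ζ * (z - ζ)⁻¹ ∂annulusMeasure

variable {a b : ℂ → ℂ} {K L : ℝ}

lemma integrable_mul_cauchyKernel (ha : Measurable a) (hK : ∀ ζ, ‖a ζ‖ ≤ K) (z : ℂ) :
    Integrable (fun ζ => a ζ * (z - ζ)⁻¹) annulusMeasure :=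
  (integrable_cauchyKernel z).bdd_mul (c := K) ha.aestronglyMeasurable (ae_of_all _ hK)

lemma integral_norm_mul_cauchyKernel_le (ha : Measurable a) (hK : ∀ ζ, ‖a ζ‖ ≤ K) (z : ℂ) :
    ∫ ζ, ‖a ζ * (z - ζ)⁻¹‖ ∂annulusMeasure ≤ kernelBound * K := by
  have hK0 : 0 ≤ K := (norm_nonneg _).trans (hK 0)
  calc _ ≤ ∫ ζ, K * ‖(z - ζ)⁻¹‖ ∂annulusMeasure := by
        refine integral_mono (integrable_mul_cauchyKernel ha hK z).norm
          ((integrable_cauchyKernel z).norm.const_mul _) fun ζ => ?_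
        simp only [norm_mul]
        gcongr
        exact hK ζ
    _ ≤ _ := by
        rw [integral_const_mul, mul_comm]
        gcongr
        exact integral_norm_cauchyKernel_le z

lemma norm_cauchyTransform_le (ha : Measurable a) (hK : ∀ ζ, ‖a ζ‖ ≤ K) (z : ℂ) :
    ‖cauchyTransform a z‖ ≤ kernelBound * K :=
  (norm_integral_le_integral_norm _).trans (integral_norm_mul_cauchyKernel_le ha hK z)

lemma continuous_cauchyTransform (ha : Measurable a) (hK : ∀ ζ, ‖a ζ‖ ≤ K) :
    Continuous (cauchyTransform a) := by
  have hK0 : 0 ≤ K := (norm_nonneg _).trans (hK 0)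
  -- the kernel truncated at distance `ε` from the singularity
  let k : ℝ → ℂ → ℂ := fun ε w => (starRingEnd ℂ) w / ((max (‖w‖ ^ 2) (ε ^ 2) : ℝ) : ℂ)
  have hk_out : ∀ ε > 0, ∀ w, ε ≤ ‖w‖ → k ε w = w⁻¹ := by
    intro ε hε w hw
    simp only [k]
    rw [max_eq_left (by gcongr), Complex.inv_def, normSq_eq_norm_sq, div_eq_mul_inv]
    push_cast; rfl
  have hk_in : ∀ ε > 0, ∀ w, ‖k ε w‖ ≤ ‖w⁻¹‖ := by
    intro ε hε w
    rcases eq_or_ne w 0 with rfl | hw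
    · simp [k]
    have : 0 < ‖w‖ := norm_pos_iff.2 hw
    simp only [k, norm_div, RCLike.norm_conj, norm_inv, norm_real, Real.norm_eq_abs]
    rw [abs_of_pos (lt_max_of_lt_right (by positivity)), inv_eq_one_div,
      div_le_div_iff₀ (lt_max_of_lt_right (by positivity)) this]
    calc ‖w‖ * ‖w‖ = ‖w‖ ^ 2 := by ring
      _ ≤ 1 * max (‖w‖ ^ 2) (ε ^ 2) := by rw [one_mul]; exact le_max_left _ _
  have hk_bd : ∀ ε > 0, ∀ w, ‖k ε w‖ ≤ ε⁻¹ := by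
    intro ε hε w
    simp only [k, norm_div, RCLike.norm_conj, norm_real, Real.norm_eq_abs]
    rw [abs_of_pos (lt_max_of_lt_right (by positivity)), inv_eq_one_div,
      div_le_div_iff₀ (lt_max_of_lt_right (by positivity)) hε, one_mul]
    rcases le_total ‖w‖ ε with h | h
    · exact le_trans (by nlinarith [norm_nonneg w]) (le_max_right _ _)
    · exact le_trans (by nlinarith [norm_nonneg w]) (le_max_left _ _)
  have hk_cont : ∀ ε > 0, Continuous (k ε) := by
    intro ε hε
    refine continuous_conj.div (by fun_prop) fun w => ?_
    exact_mod_cast (lt_max_of_lt_right (by positivity)).ne'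
  let C : ℝ → ℂ → ℂ := fun ε z => ∫ ζ, a ζ * k ε (z - ζ) ∂annulusMeasure
  have hC_cont : ∀ ε > 0, Continuous (C ε) := by
    intro ε hε
    refine continuous_of_dominated (bound := fun _ => K * ε⁻¹) (fun z => ?_) (fun z => ?_)
      (integrable_const _) ?_
    · exact (ha.mul ((hk_cont ε hε).measurable.comp (by fun_prop))).aestronglyMeasurable
    · refine ae_of_all _ fun ζ => ?_
      rw [norm_mul]
      exact mul_le_mul (hK ζ) (hk_bd ε hε _) (norm_nonneg _) hK0
    · refine ae_of_all _ fun ζ => ?_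
      exact continuous_const.mul ((hk_cont ε hε).comp (by fun_prop))
  have hdiff : ∀ ε > 0, ∀ z, ‖cauchyTransform a z - C ε z‖ ≤ K * 2 * (2 * Real.pi * ε) := by
    intro ε hε z
    have h_int : Integrable (fun ζ => a ζ * k ε (z - ζ)) annulusMeasure := by
      refine (integrable_mul_cauchyKernel ha hK z).mono
        (ha.mul ((hk_cont ε hε).measurable.comp (by fun_prop))).aestronglyMeasurable
        (ae_of_all _ fun ζ => ?_)
      rw [norm_mul, norm_mul]
      gcongr
      exact hk_in ε hε _
    have hI : IntegrableOn (fun ζ => (z - ζ)⁻¹) (ball z ε) volume :=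
      ⟨by fun_prop, (lintegral_enorm_inv_sub_ball_le z ε).trans_lt ENNReal.ofReal_lt_top⟩
    have hle : ∀ ζ, ‖a ζ * (z - ζ)⁻¹ - a ζ * k ε (z - ζ)‖ ≤
        (ball z ε).indicator (fun ζ => K * 2 * ‖(z - ζ)⁻¹‖) ζ := by
      intro ζ
      by_cases h : ζ ∈ ball z ε
      · rw [indicator_of_mem h, ← mul_sub, norm_mul, mul_assoc]
        refine mul_le_mul (hK ζ) ((norm_sub_le _ _).trans ?_) (norm_nonneg _) hK0
        linarith [hk_in ε hε (z - ζ)]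
      · rw [indicator_of_notMem h, hk_out ε hε]
        · simp
        · simpa [dist_eq_norm, norm_sub_rev] using h
    have hI2 : Integrable ((ball z ε).indicator (fun ζ => K * 2 * ‖(z - ζ)⁻¹‖)) volume :=
      (integrable_indicator_iff measurableSet_ball).2 (hI.norm.const_mul _)
    rw [cauchyTransform, ← integral_sub (integrable_mul_cauchyKernel ha hK z) h_int]
    calc _ ≤ ∫ ζ, (ball z ε).indicator (fun ζ => K * 2 * ‖(z - ζ)⁻¹‖) ζ ∂annulusMeasure :=
          norm_integral_le_of_norm_le hI2.restrict (ae_of_all _ hle)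
      _ ≤ ∫ ζ, (ball z ε).indicator (fun ζ => K * 2 * ‖(z - ζ)⁻¹‖) ζ :=
          integral_mono_measure Measure.restrict_le_self
            (ae_of_all _ fun ζ => indicator_nonneg (fun _ _ => by positivity) _) hI2
      _ = K * 2 * ∫ ζ in ball z ε, ‖(z - ζ)⁻¹‖ := by
          rw [integral_indicator measurableSet_ball, integral_const_mul]
      _ ≤ _ := by
          gcongr
          rw [integral_norm_eq_lintegral_enorm (by fun_prop)]
          exact ENNReal.toReal_le_of_le_ofReal (by positivity)
            (lintegral_enorm_inv_sub_ball_le z ε)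
  have hlim : TendstoUniformly C (cauchyTransform a) (𝓝[>] 0) := by
    rw [Metric.tendstoUniformly_iff]
    intro δ hδ
    have h1 : Tendsto (fun ε : ℝ => K * 2 * (2 * Real.pi * ε)) (𝓝[>] 0) (𝓝 0) := by
      refine tendsto_nhdsWithin_of_tendsto_nhds ?_
      have : Continuous fun ε : ℝ => K * 2 * (2 * Real.pi * ε) := by fun_prop
      simpa using this.tendsto 0
    filter_upwards [h1.eventually (gt_mem_nhds hδ), self_mem_nhdsWithin] with ε h2 h3 z
    rw [dist_eq_norm]
    exact (hdiff ε h3 z).trans_lt h2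
  exact hlim.continuous (Eventually.frequently
    (eventually_mem_nhdsWithin.mono fun ε hε => hC_cont ε hε))

lemma integrable_cauchyKernel_prod (ha : Measurable a) (hK : ∀ ζ, ‖a ζ‖ ≤ K)
    (hb : Measurable b) (hL : ∀ ζ, ‖b ζ‖ ≤ L) (z : ℂ) :
    Integrable (fun p : ℂ × ℂ => a p.1 * (z - p.1)⁻¹ * (b p.2 * (p.1 - p.2)⁻¹))
      (annulusMeasure.prod annulusMeasure) := by
  have hm : AEStronglyMeasurable (fun p : ℂ × ℂ => a p.1 * (z - p.1)⁻¹ * (b p.2 * (p.1 - p.2)⁻¹))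
      (annulusMeasure.prod annulusMeasure) := by
    apply Measurable.aestronglyMeasurable; fun_prop
  rw [integrable_prod_iff hm]
  refine ⟨ae_of_all _ fun ζ =>
    (integrable_mul_cauchyKernel hb hL ζ).const_mul (a ζ * (z - ζ)⁻¹), ?_⟩
  refine ((integrable_mul_cauchyKernel ha hK z).norm.mul_const (kernelBound * L)).mono
    hm.norm.integral_prod_right' (ae_of_all _ fun ζ => ?_)
  simp only [norm_mul (a ζ * (z - ζ)⁻¹), integral_const_mul]
  rw [Real.norm_of_nonneg (by positivity), Real.norm_of_nonneg]
  · gcongr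
    exact integral_norm_mul_cauchyKernel_le hb hL ζ
  · have : 0 ≤ L := (norm_nonneg _).trans (hL 0)
    have := kernelBound_nonneg
    positivity

/-- The Cauchy transform is a Rota–Baxter operator of weight zero. -/
lemma cauchyTransform_mul (ha : Measurable a) (hK : ∀ ζ, ‖a ζ‖ ≤ K)
    (hb : Measurable b) (hL : ∀ ζ, ‖b ζ‖ ≤ L) (z : ℂ) :
    cauchyTransform a z * cauchyTransform b z =
      cauchyTransform (fun ζ => a ζ * cauchyTransform b ζ + b ζ * cauchyTransform a ζ) z := by
  have hA := integrable_cauchyKernel_prod ha hK hb hL z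
  have hB := integrable_cauchyKernel_prod hb hL ha hK z
  have hB' : Integrable (fun p : ℂ × ℂ => b p.2 * (z - p.2)⁻¹ * (a p.1 * (p.2 - p.1)⁻¹))
      (annulusMeasure.prod annulusMeasure) := hB.swap
  have hCa := (continuous_cauchyTransform ha hK).measurable
  have hCb := (continuous_cauchyTransform hb hL).measurable
  have hne : ∀ w : ℂ, ∀ᵐ ζ ∂annulusMeasure, ζ ≠ w := fun w => by
    simp [ae_iff]
  have hdiag : ∀ᵐ p : ℂ × ℂ ∂annulusMeasure.prod annulusMeasure,
      p.1 ≠ z ∧ p.2 ≠ z ∧ p.2 ≠ p.1 := by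
    rw [Measure.ae_prod_iff_ae_ae]
    · filter_upwards [hne z] with ζ h1
      filter_upwards [hne z, hne ζ] with η h2 h3 using ⟨h1, h2, h3⟩
    · have h1 : IsOpen {p : ℂ × ℂ | p.1 ≠ z} := isOpen_ne_fun (by fun_prop) (by fun_prop)
      have h2 : IsOpen {p : ℂ × ℂ | p.2 ≠ z} := isOpen_ne_fun (by fun_prop) (by fun_prop)
      have h3 : IsOpen {p : ℂ × ℂ | p.2 ≠ p.1} := isOpen_ne_fun (by fun_prop) (by fun_prop)
      exact (h1.inter (h2.inter h3)).measurableSet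
  have hI1 : ∫ p : ℂ × ℂ, a p.1 * (z - p.1)⁻¹ * (b p.2 * (p.1 - p.2)⁻¹)
      ∂annulusMeasure.prod annulusMeasure =
        cauchyTransform (fun ζ => a ζ * cauchyTransform b ζ) z := by
    rw [integral_prod _ hA, cauchyTransform]
    refine integral_congr_ae (ae_of_all _ fun ζ => ?_)
    simp only [integral_const_mul]
    rw [cauchyTransform]; ring
  have hI2 : ∫ p : ℂ × ℂ, b p.2 * (z - p.2)⁻¹ * (a p.1 * (p.2 - p.1)⁻¹)
      ∂annulusMeasure.prod annulusMeasure =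
        cauchyTransform (fun ζ => b ζ * cauchyTransform a ζ) z := by
    rw [integral_prod_symm _ hB', cauchyTransform]
    refine integral_congr_ae (ae_of_all _ fun ζ => ?_)
    simp only [integral_const_mul]
    rw [cauchyTransform]; ring
  calc cauchyTransform a z * cauchyTransform b z
      = ∫ p : ℂ × ℂ, (a p.1 * (z - p.1)⁻¹) * (b p.2 * (z - p.2)⁻¹)
          ∂annulusMeasure.prod annulusMeasure := (integral_prod_mul _ _).symm
    _ = ∫ p : ℂ × ℂ, (a p.1 * (z - p.1)⁻¹ * (b p.2 * (p.1 - p.2)⁻¹) +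
          b p.2 * (z - p.2)⁻¹ * (a p.1 * (p.2 - p.1)⁻¹))
          ∂annulusMeasure.prod annulusMeasure := by
        refine integral_congr_ae ?_
        filter_upwards [hdiag] with p ⟨h1, h2, h3⟩
        have e1 := sub_ne_zero.2 h1.symm
        have e2 := sub_ne_zero.2 h2.symm
        have e3 := sub_ne_zero.2 h3
        have e4 := sub_ne_zero.2 h3.symm
        field_simp
        ring
    _ = _ := by
        rw [integral_add hA hB', hI1, hI2, cauchyTransform, cauchyTransform, cauchyTransform,
          ← integral_add]
        · congr 1 with ζ; ring
        · refine integrable_mul_cauchyKernel (K := K * (kernelBound * L)) (by fun_prop)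
            (fun ζ => ?_) z
          rw [norm_mul]
          exact mul_le_mul (hK _) (norm_cauchyTransform_le hb hL _) (norm_nonneg _)
            ((norm_nonneg _).trans (hK 0))
        · refine integrable_mul_cauchyKernel (K := L * (kernelBound * K)) (by fun_prop)
            (fun ζ => ?_) z
          rw [norm_mul]
          exact mul_le_mul (hL _) (norm_cauchyTransform_le ha hK _) (norm_nonneg _)
            ((norm_nonneg _).trans (hL 0))

lemma cauchyTransform_add (ha : Measurable a) (hK : ∀ ζ, ‖a ζ‖ ≤ K)
    (hb : Measurable b) (hL : ∀ ζ, ‖b ζ‖ ≤ L) (z : ℂ) :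
    cauchyTransform (fun ζ => a ζ + b ζ) z = cauchyTransform a z + cauchyTransform b z := by
  simp only [cauchyTransform, add_mul]
  exact integral_add (integrable_mul_cauchyKernel ha hK z) (integrable_mul_cauchyKernel hb hL z)

lemma cauchyTransform_const_mul (c : ℂ) (a : ℂ → ℂ) (z : ℂ) :
    cauchyTransform (fun ζ => c * a ζ) z = c * cauchyTransform a z := by
  simp only [cauchyTransform, mul_assoc, integral_const_mul]

lemma differentiableOn_cauchyTransform (ha : Measurable a) (hK : ∀ ζ, ‖a ζ‖ ≤ K) :
    DifferentiableOn ℂ (cauchyTransform a) (ball 0 1) := by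
  have hK0 : 0 ≤ K := (norm_nonneg _).trans (hK 0)
  intro z₀ hz₀
  rw [mem_ball_zero_iff] at hz₀
  set δ := (1 - ‖z₀‖) / 2 with hδ
  have hδ0 : 0 < δ := by rw [hδ]; linarith
  have hfar : ∀ᵐ ζ ∂annulusMeasure, ∀ z ∈ ball z₀ δ, δ ≤ ‖z - ζ‖ := by
    refine (ae_restrict_iff' (measurableSet_closedBall.diff measurableSet_ball)).2
      (ae_of_all _ fun ζ hζ z hz => ?_)
    have h1 : 1 ≤ ‖ζ‖ := by simpa using hζ.2
    have h2 : ‖z - z₀‖ < δ := by simpa [dist_eq_norm] using hz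
    have h3 : ‖ζ‖ ≤ ‖z - ζ‖ + ‖z - z₀‖ + ‖z₀‖ := by
      have : ζ = -(z - ζ) + (z - z₀) + z₀ := by ring
      calc ‖ζ‖ = ‖-(z - ζ) + (z - z₀) + z₀‖ := by rw [← this]
        _ ≤ _ := by
          refine (norm_add₃_le).trans ?_
          rw [norm_neg]
    linarith
  have := (hasDerivAt_integral_of_dominated_loc_of_deriv_le (μ := annulusMeasure)
    (F := fun z ζ => a ζ * (z - ζ)⁻¹) (F' := fun z ζ => a ζ * (-1 / (z - ζ) ^ 2))
    (bound := fun _ => K * (1 / δ ^ 2)) (x₀ := z₀) (ball_mem_nhds z₀ hδ0)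
    (Eventually.of_forall fun z => (integrable_mul_cauchyKernel ha hK z).1)
    (integrable_mul_cauchyKernel ha hK z₀)
    (by apply Measurable.aestronglyMeasurable; fun_prop) ?_ (integrable_const _) ?_).2
  · exact this.differentiableAt.differentiableWithinAt
  · filter_upwards [hfar] with ζ h z hz
    rw [norm_mul, norm_div, norm_neg, norm_one, norm_pow]
    refine mul_le_mul (hK ζ) ?_ (by positivity) hK0
    have := h z hz
    gcongr
  · filter_upwards [hfar] with ζ h z hz
    have hne : z - ζ ≠ 0 := norm_pos_iff.1 (hδ0.trans_le (h z hz))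
    exact (((hasDerivAt_id z).sub_const ζ).inv hne).const_mul (a ζ)

/-- The Cauchy transform over the annulus, normalised to vanish at the origin. -/
def cauchyOp (a : ℂ → ℂ) (z : ℂ) : ℂ := cauchyTransform a z - cauchyTransform a 0

/-- A bound for the operator `cauchyOp` in the uniform norm. -/
def opBound : ℝ := 2 * kernelBound

lemma opBound_nonneg : 0 ≤ opBound := mul_nonneg zero_le_two kernelBound_nonneg

@[simp] lemma cauchyOp_zero_right (a : ℂ → ℂ) : cauchyOp a 0 = 0 := sub_self _

lemma norm_cauchyOp_le (ha : Measurable a) (hK : ∀ ζ, ‖a ζ‖ ≤ K) (z : ℂ) :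
    ‖cauchyOp a z‖ ≤ opBound * K := by
  refine (norm_sub_le _ _).trans ?_
  have h1 := norm_cauchyTransform_le ha hK z
  have h2 := norm_cauchyTransform_le ha hK 0
  rw [opBound]; linarith

lemma continuous_cauchyOp (ha : Measurable a) (hK : ∀ ζ, ‖a ζ‖ ≤ K) : Continuous (cauchyOp a) :=
  (continuous_cauchyTransform ha hK).sub continuous_const

lemma differentiableOn_cauchyOp (ha : Measurable a) (hK : ∀ ζ, ‖a ζ‖ ≤ K) :
    DifferentiableOn ℂ (cauchyOp a) (ball 0 1) :=
  (differentiableOn_cauchyTransform ha hK).sub_const _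

lemma cauchyOp_add (ha : Measurable a) (hK : ∀ ζ, ‖a ζ‖ ≤ K)
    (hb : Measurable b) (hL : ∀ ζ, ‖b ζ‖ ≤ L) (z : ℂ) :
    cauchyOp (fun ζ => a ζ + b ζ) z = cauchyOp a z + cauchyOp b z := by
  simp only [cauchyOp, cauchyTransform_add ha hK hb hL]; ring

lemma cauchyOp_const_mul (c : ℂ) (a : ℂ → ℂ) (z : ℂ) :
    cauchyOp (fun ζ => c * a ζ) z = c * cauchyOp a z := by
  simp only [cauchyOp, cauchyTransform_const_mul]; ring

lemma cauchyOp_sub (ha : Measurable a) (hK : ∀ ζ, ‖a ζ‖ ≤ K)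
    (hb : Measurable b) (hL : ∀ ζ, ‖b ζ‖ ≤ L) (z : ℂ) :
    cauchyOp (fun ζ => a ζ - b ζ) z = cauchyOp a z - cauchyOp b z := by
  have h := cauchyOp_add ha hK (hb.const_mul (-1))
    (fun ζ => by simpa using hL ζ : ∀ ζ, ‖-1 * b ζ‖ ≤ L) z
  rw [cauchyOp_const_mul] at h
  simpa [sub_eq_add_neg] using h

/-- The normalised Cauchy operator is Rota–Baxter of weight zero. -/
lemma cauchyOp_mul (ha : Measurable a) (hK : ∀ ζ, ‖a ζ‖ ≤ K)
    (hb : Measurable b) (hL : ∀ ζ, ‖b ζ‖ ≤ L) (z : ℂ) :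
    cauchyOp a z * cauchyOp b z =
      cauchyOp (fun ζ => a ζ * cauchyOp b ζ + b ζ * cauchyOp a ζ) z := by
  have hCa := (continuous_cauchyTransform ha hK).measurable
  have hCb := (continuous_cauchyTransform hb hL).measurable
  have hK0 : 0 ≤ K := (norm_nonneg _).trans (hK 0)
  have hL0 : 0 ≤ L := (norm_nonneg _).trans (hL 0)
  have hB := kernelBound_nonneg
  have key : ∀ w, cauchyTransform (fun ζ => a ζ * cauchyOp b ζ + b ζ * cauchyOp a ζ) w =
      cauchyTransform a w * cauchyTransform b w - cauchyTransform b 0 * cauchyTransform a w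
        - cauchyTransform a 0 * cauchyTransform b w := by
    intro w
    have e : (fun ζ => a ζ * cauchyOp b ζ + b ζ * cauchyOp a ζ) = fun ζ =>
        (a ζ * cauchyTransform b ζ + b ζ * cauchyTransform a ζ) +
          ((-cauchyTransform b 0) * a ζ + (-cauchyTransform a 0) * b ζ) := by
      funext ζ; simp only [cauchyOp]; ring
    have n1 : ∀ ζ, ‖a ζ * cauchyTransform b ζ + b ζ * cauchyTransform a ζ‖ ≤
        K * (kernelBound * L) + L * (kernelBound * K) := fun ζ => by
      refine norm_add_le_of_le ?_ ?_ <;> rw [norm_mul]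
      · exact mul_le_mul (hK _) (norm_cauchyTransform_le hb hL _) (norm_nonneg _) hK0
      · exact mul_le_mul (hL _) (norm_cauchyTransform_le ha hK _) (norm_nonneg _) hL0
    have n2 : ∀ ζ, ‖-cauchyTransform b 0 * a ζ‖ ≤ ‖cauchyTransform b 0‖ * K := fun ζ => by
      rw [norm_mul, norm_neg]; gcongr; exact hK ζ
    have n3 : ∀ ζ, ‖-cauchyTransform a 0 * b ζ‖ ≤ ‖cauchyTransform a 0‖ * L := fun ζ => by
      rw [norm_mul, norm_neg]; gcongr; exact hL ζ
    rw [e, cauchyTransform_add (by fun_prop) n1 (by fun_prop)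
      (fun ζ => norm_add_le_of_le (n2 ζ) (n3 ζ)), cauchyTransform_add (by fun_prop) n2
      (by fun_prop) n3, cauchyTransform_const_mul, cauchyTransform_const_mul,
      ← cauchyTransform_mul ha hK hb hL]
    ring
  rw [cauchyOp, cauchyOp, cauchyOp, key, key]
  ring

end CauchyTransform

section PlaneDensity
open MeasureTheory Filter Topology

lemma integral_eq_polar {f : ℂ → ℂ} (hf : Integrable f) (hm : Measurable f) :
    ∫ ζ, f ζ = ∫ s in Ioi (0 : ℝ), ∫ θ in Ioo (-Real.pi) Real.pi,
      (s : ℂ) * f (circleMap 0 s θ) := by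
  have hsymm : ∀ p : ℝ × ℝ, Complex.polarCoord.symm p = circleMap 0 p.1 p.2 := fun p => by
    rw [Complex.polarCoord_symm_apply, circleMap, exp_mul_I]; simp
  have hcm : Measurable fun p : ℝ × ℝ => (p.1 : ℂ) * f (circleMap 0 p.1 p.2) := by
    unfold circleMap; fun_prop
  rw [← Complex.integral_comp_polarCoord_symm]
  simp only [hsymm, real_smul]
  rw [polarCoord_target, Measure.volume_eq_prod, setIntegral_prod]
  refine ⟨hcm.aestronglyMeasurable, ?_⟩
  have h := Complex.lintegral_comp_polarCoord_symm fun ζ => ‖f ζ‖ₑ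
  simp only [hsymm] at h
  rw [HasFiniteIntegral, ← Measure.volume_eq_prod, ← polarCoord_target]
  refine lt_of_eq_of_lt ?_ (h.trans_lt hf.2)
  refine setLIntegral_congr_fun polarCoord.open_target.measurableSet fun p hp => ?_
  simp only [polarCoord_target, mem_prod, mem_Ioi] at hp
  simp only [enorm_mul, smul_eq_mul]
  congr 1
  rw [← ofReal_norm, norm_real, Real.norm_of_nonneg hp.1.le]

/-- A density whose Cauchy transform is the identity on the unit disk and maps the plane into
the closed unit disk. -/
def retractDensity (ζ : ℂ) : ℂ := -(2 * Real.pi : ℂ)⁻¹ * (ζ / (starRingEnd ℂ) ζ)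

lemma measurable_retractDensity : Measurable retractDensity := by
  have : Measurable (starRingEnd ℂ) := continuous_conj.measurable
  unfold retractDensity; fun_prop

lemma norm_retractDensity_le (ζ : ℂ) : ‖retractDensity ζ‖ ≤ 1 := by
  rw [retractDensity, norm_mul, norm_neg, norm_inv, norm_div, RCLike.norm_conj]
  have h1 : ‖(2 * Real.pi : ℂ)‖⁻¹ ≤ 1 := by
    rw [norm_mul, norm_real, Real.norm_of_nonneg Real.pi_pos.le, norm_ofNat]
    exact inv_le_one_of_one_le₀ (by linarith [Real.pi_gt_three])
  exact mul_le_one₀ h1 (by positivity) (div_self_le_one _)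

lemma integral_retractDensity_circle {z : ℂ} {s : ℝ} (hs : 0 < s) (hz : ‖z‖ ≠ s) :
    ∫ θ in Ioo (-Real.pi) Real.pi,
      (s : ℂ) * (retractDensity (circleMap 0 s θ) * (z - circleMap 0 s θ)⁻¹) =
    if ‖z‖ < s then z * (s : ℂ)⁻¹ else 0 := by
  have hs' : (s : ℂ) ≠ 0 := ofReal_ne_zero.2 hs.ne'
  have hpi : (Real.pi : ℂ) ≠ 0 := ofReal_ne_zero.2 Real.pi_ne_zero
  have hne : ∀ θ, z - circleMap 0 s θ ≠ 0 := fun θ h => hz (by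
    rw [sub_eq_zero.1 h]; simp [abs_of_pos hs])
  have e1 : ∀ θ : ℝ, (s : ℂ) * (retractDensity (circleMap 0 s θ) * (z - circleMap 0 s θ)⁻¹) =
      -(2 * Real.pi * I * s)⁻¹ * (deriv (circleMap 0 s) θ •
        ((z - circleMap 0 s θ)⁻¹ * circleMap 0 s θ)) := by
    intro θ
    have h0 : circleMap 0 s θ ≠ 0 := circleMap_ne_center hs.ne'
    have hc : circleMap 0 s θ * (starRingEnd ℂ) (circleMap 0 s θ) = (s : ℂ) ^ 2 := by
      rw [mul_conj, normSq_eq_norm_sq]; simp [abs_of_pos hs]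
    have h1 : circleMap 0 s θ / (starRingEnd ℂ) (circleMap 0 s θ) =
        circleMap 0 s θ ^ 2 / (s : ℂ) ^ 2 := by
      rw [← hc]
      have : (starRingEnd ℂ) (circleMap 0 s θ) ≠ 0 := by simpa using h0
      field_simp
    rw [retractDensity, h1, deriv_circleMap, smul_eq_mul]
    have := hne θ
    field_simp
  have hper : Function.Periodic (fun θ : ℝ => deriv (circleMap 0 s) θ •
        ((z - circleMap 0 s θ)⁻¹ * circleMap 0 s θ)) (2 * Real.pi) := by
    intro θ
    simp only [deriv_circleMap, periodic_circleMap 0 s θ]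
  have e2 : ∫ θ in Ioo (-Real.pi) Real.pi, deriv (circleMap 0 s) θ •
        ((z - circleMap 0 s θ)⁻¹ * circleMap 0 s θ) =
      ∮ ζ in C(0, s), (z - ζ)⁻¹ * ζ := by
    rw [circleIntegral, ← integral_Ioc_eq_integral_Ioo,
      ← intervalIntegral.integral_of_le (by linarith [Real.pi_pos])]
    have := hper.intervalIntegral_add_eq (-Real.pi) 0
    rw [zero_add, show -Real.pi + 2 * Real.pi = Real.pi by ring] at this
    exact this
  simp only [e1]
  rw [integral_const_mul, e2]
  split_ifs with h
  · have h3 : ∮ ζ in C(0, s), (ζ - z)⁻¹ • ζ = (2 * Real.pi * I : ℂ) • z :=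
      (differentiable_id.diffContOnCl (s := ball 0 s)).circleIntegral_sub_inv_smul
        (by simpa using h)
    have h4 : ∮ ζ in C(0, s), (z - ζ)⁻¹ * ζ = -∮ ζ in C(0, s), (ζ - z)⁻¹ • ζ := by
      rw [← neg_one_smul ℂ (∮ ζ in C(0, s), (ζ - z)⁻¹ • ζ), ← circleIntegral.integral_smul]
      congr 1 with ζ
      rw [← neg_sub, inv_neg]; simp
    rw [h4, h3, smul_eq_mul]
    field_simp
  · have hd : DiffContOnCl ℂ (fun ζ => (z - ζ)⁻¹ * ζ) (ball 0 s) := by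
      apply DifferentiableOn.diffContOnCl
      intro ζ hζ
      have h5 : ‖ζ‖ ≤ s := by
        rw [closure_ball _ hs.ne'] at hζ; simpa using hζ
      have : z - ζ ≠ 0 := fun h6 => h (by
        rw [sub_eq_zero.1 h6] at hz ⊢
        exact lt_of_le_of_ne h5 hz)
      exact (((differentiableAt_id.const_sub z).inv this).mul
        differentiableAt_id).differentiableWithinAt
    rw [hd.circleIntegral_eq_zero hs.le, mul_zero]

lemma cauchyTransform_retractDensity (z : ℂ) :
    cauchyTransform retractDensity z =
      z * ∫ s in Icc 1 (Real.exp 1) ∩ Ioi ‖z‖, (s : ℂ)⁻¹ := by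
  have hmeas : MeasurableSet (closedBall (0 : ℂ) (Real.exp 1) \ ball 0 1) :=
    measurableSet_closedBall.diff measurableSet_ball
  have hI := integrable_mul_cauchyKernel measurable_retractDensity norm_retractDensity_le z
  have hm : Measurable fun ζ => retractDensity ζ * (z - ζ)⁻¹ := by
    have := measurable_retractDensity
    fun_prop
  rw [annulusMeasure] at hI
  rw [cauchyTransform, annulusMeasure, ← integral_indicator hmeas,
    integral_eq_polar ((integrable_indicator_iff hmeas).2 hI) (hm.indicator hmeas),
    ← integral_const_mul, ← integral_indicator (measurableSet_Icc.inter measurableSet_Ioi),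
    ← integral_indicator measurableSet_Ioi]
  refine integral_congr_ae ?_
  have hne : ∀ᵐ s : ℝ, s ≠ ‖z‖ := by simp [ae_iff]
  filter_upwards [hne] with s hs
  by_cases h0 : 0 < s
  swap
  · rw [indicator_of_notMem (by simpa using h0), indicator_of_notMem]
    rintro ⟨h1, -⟩
    exact h0 (one_pos.trans_le h1.1)
  rw [indicator_of_mem (by simpa using h0)]
  by_cases h1 : s ∈ Icc 1 (Real.exp 1)
  · have h2 : ∀ θ, circleMap 0 s θ ∈ closedBall (0 : ℂ) (Real.exp 1) \ ball 0 1 := fun θ => by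
      simpa [abs_of_pos h0, and_comm] using h1
    simp only [indicator_of_mem (h2 _)]
    rw [integral_retractDensity_circle h0 hs.symm]
    by_cases h3 : ‖z‖ < s
    · have h4 : s ∈ Icc 1 (Real.exp 1) ∩ Ioi ‖z‖ := ⟨h1, h3⟩
      rw [if_pos h3, indicator_of_mem h4]
    · have h4 : s ∉ Icc 1 (Real.exp 1) ∩ Ioi ‖z‖ := fun h => h3 h.2
      rw [if_neg h3, indicator_of_notMem h4]
  · have h2 : ∀ θ, circleMap 0 s θ ∉ closedBall (0 : ℂ) (Real.exp 1) \ ball 0 1 := fun θ h => by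
      apply h1
      simpa [abs_of_pos h0, and_comm] using h
    simp only [indicator_of_notMem (h2 _)]
    have h4 : s ∉ Icc 1 (Real.exp 1) ∩ Ioi ‖z‖ := fun h => h1 h.1
    rw [indicator_of_notMem h4]
    simp

lemma integral_inv_Ioc {x : ℝ} (h0 : 0 < x) (h1 : x ≤ Real.exp 1) :
    ∫ s in Ioc x (Real.exp 1), (s : ℂ)⁻¹ = ((1 - Real.log x : ℝ) : ℂ) := by
  rw [← intervalIntegral.integral_of_le h1]
  simp only [← ofReal_inv]
  rw [intervalIntegral.integral_ofReal, integral_inv_of_pos h0 (Real.exp_pos 1),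
    Real.log_div (Real.exp_pos 1).ne' h0.ne', Real.log_exp]

lemma cauchyTransform_retractDensity_of_norm_lt {z : ℂ} (hz : ‖z‖ < 1) :
    cauchyTransform retractDensity z = z := by
  have h : Icc 1 (Real.exp 1) ∩ Ioi ‖z‖ = Icc 1 (Real.exp 1) :=
    inter_eq_left.2 fun s hs => hz.trans_le hs.1
  rw [cauchyTransform_retractDensity, h,
    integral_Icc_eq_integral_Ioc, integral_inv_Ioc one_pos (Real.one_le_exp zero_le_one)]
  simp

lemma cauchyOp_retractDensity_of_mem {z : ℂ} (hz : z ∈ ball (0 : ℂ) 1) :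
    cauchyOp retractDensity z = z := by
  rw [cauchyOp, cauchyTransform_retractDensity_of_norm_lt (by simpa using hz),
    cauchyTransform_retractDensity_of_norm_lt (by simp), sub_zero]

lemma norm_cauchyOp_retractDensity_le (z : ℂ) : ‖cauchyOp retractDensity z‖ ≤ 1 := by
  rcases lt_or_ge ‖z‖ 1 with h | h
  · rw [cauchyOp_retractDensity_of_mem (by simpa using h)]; exact h.le
  rw [cauchyOp, cauchyTransform_retractDensity_of_norm_lt (z := 0) (by simp), sub_zero,
    cauchyTransform_retractDensity]
  have hset : Icc 1 (Real.exp 1) ∩ Ioi ‖z‖ = Ioc ‖z‖ (Real.exp 1) := by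
    ext s
    simp only [mem_inter_iff, mem_Icc, mem_Ioi, mem_Ioc]
    constructor
    · rintro ⟨⟨-, h2⟩, h3⟩; exact ⟨h3, h2⟩
    · rintro ⟨h3, h2⟩; exact ⟨⟨by linarith, h2⟩, h3⟩
  rw [hset]
  have h0 : 0 < ‖z‖ := by linarith
  rcases le_or_gt ‖z‖ (Real.exp 1) with h1 | h1
  · rw [integral_inv_Ioc h0 h1, norm_mul, norm_real]
    have h2 : Real.log ‖z‖ ≤ 1 := by
      rw [← Real.log_exp 1]; exact Real.log_le_log h0 h1
    rw [Real.norm_of_nonneg (by linarith)]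
    have h3 := Real.one_sub_inv_le_log_of_pos h0
    calc ‖z‖ * (1 - Real.log ‖z‖) ≤ ‖z‖ * ‖z‖⁻¹ := by gcongr; linarith
      _ = 1 := mul_inv_cancel₀ h0.ne'
  · rw [Ioc_eq_empty (by linarith)]; simp

end PlaneDensity

section CauchyTransformComp
open MeasureTheory Filter Topology

lemma exists_polynomial_approx {f : ℂ → ℂ} {ρ R : ℝ} (hR : ρ < R)
    (hf : DifferentiableOn ℂ f (ball 0 R)) {ε : ℝ} (hε : 0 < ε) :
    ∃ p : Polynomial ℂ, ∀ z ∈ closedBall (0 : ℂ) ρ, ‖f z - p.eval z‖ ≤ ε := by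
  rcases lt_or_ge ρ 0 with h | hρ
  · exact ⟨0, fun z hz => by rw [closedBall_eq_empty.2 h] at hz; exact hz.elim⟩
  obtain ⟨s, hs1, hs2⟩ := exists_between hR
  obtain ⟨t, ht1, ht2⟩ := exists_between hs1
  lift s to NNReal using by linarith
  lift t to NNReal using by linarith
  have hs0 : 0 < s := by exact_mod_cast hρ.trans_lt hs1
  have hd : DiffContOnCl ℂ f (ball 0 s) :=
    DifferentiableOn.diffContOnCl (hf.mono ((closure_ball_subset_closedBall).trans
      (closedBall_subset_ball hs2)))
  have hp := hd.hasFPowerSeriesOnBall hs0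
  have hu := hp.tendstoUniformlyOn (r' := t) (by exact_mod_cast ht2)
  rw [Metric.tendstoUniformlyOn_iff] at hu
  obtain ⟨n, hn⟩ := (hu ε hε).exists
  set q := cauchyPowerSeries f 0 s
  refine ⟨∑ k ∈ Finset.range n, Polynomial.C (q.coeff k) * Polynomial.X ^ k, fun z hz => ?_⟩
  have hz' : z ∈ ball (0 : ℂ) t := closedBall_subset_ball ht1 hz
  have := (hn z hz').le
  rw [dist_eq_norm, zero_add] at this
  have he : Polynomial.eval z (∑ k ∈ Finset.range n, Polynomial.C (q.coeff k) * Polynomial.X ^ k) =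
      q.partialSum n z := by
    rw [FormalMultilinearSeries.partialSum, Polynomial.eval_finsetSum]
    refine Finset.sum_congr rfl fun k _ => ?_
    rw [FormalMultilinearSeries.apply_eq_pow_smul_coeff, Polynomial.eval_C_mul,
      Polynomial.eval_X_pow, smul_eq_mul, mul_comm]
  rwa [he]

lemma exists_polynomial_approx_deriv {f : ℂ → ℂ} {ρ R : ℝ} (hR : ρ < R)
    (hf : DifferentiableOn ℂ f (ball 0 R)) {ε : ℝ} (hε : 0 < ε) :
    ∃ p : Polynomial ℂ, ∀ z ∈ closedBall (0 : ℂ) ρ, ‖f z - p.eval z‖ ≤ ε ∧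
      ‖deriv f z - p.derivative.eval z‖ ≤ ε := by
  obtain ⟨s, hs1, hs2⟩ := exists_between hR
  have h0 : 0 < s - ρ := by linarith
  obtain ⟨p, hp⟩ := exists_polynomial_approx hs2 hf (ε := min ε (ε * (s - ρ))) (by positivity)
  refine ⟨p, fun z hz => ⟨(hp z (closedBall_subset_closedBall hs1.le hz)).trans (min_le_left _ _),
    ?_⟩⟩
  have hz' := mem_closedBall_zero_iff.1 hz
  have hsub : closedBall z (s - ρ) ⊆ closedBall 0 s := fun w hw => by
    rw [mem_closedBall, dist_eq_norm] at hw
    rw [mem_closedBall_zero_iff]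
    have := norm_add_le (w - z) z
    rw [sub_add_cancel] at this
    linarith
  have hfd : DifferentiableOn ℂ (fun w => f w - p.eval w) (ball 0 R) :=
    hf.sub p.differentiable.differentiableOn
  have hd : DiffContOnCl ℂ (fun w => f w - p.eval w) (ball z (s - ρ)) :=
    DifferentiableOn.diffContOnCl (hfd.mono ((closure_ball_subset_closedBall.trans hsub).trans
      (closedBall_subset_ball hs2)))
  have h1 := norm_deriv_le_of_forall_mem_sphere_norm_le h0 hd
    (fun w hw => (hp w (hsub (sphere_subset_closedBall hw))).trans (min_le_right _ _))
  have hfz : DifferentiableAt ℂ f z :=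
    hf.differentiableAt (isOpen_ball.mem_nhds (closedBall_subset_ball hR hz))
  rwa [deriv_fun_sub hfz p.differentiableAt, Polynomial.deriv, mul_div_cancel_right₀ _ h0.ne'] at h1

variable {a : ℂ → ℂ} {K : ℝ}

lemma pow_cauchyOp (ha : Measurable a) (hK : ∀ ζ, ‖a ζ‖ ≤ K) (n : ℕ) (z : ℂ) :
    cauchyOp a z ^ (n + 1) =
      cauchyOp (fun ζ => ((n + 1 : ℕ) : ℂ) * cauchyOp a ζ ^ n * a ζ) z := by
  have hc := continuous_cauchyOp ha hK
  have hm := hc.measurable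
  have hb := norm_cauchyOp_le ha hK
  have hB : 0 ≤ opBound * K := (norm_nonneg _).trans (hb 0)
  induction n generalizing z with
  | zero => simp
  | succ n ih =>
    have hb1 : ∀ ζ, ‖((n + 1 : ℕ) : ℂ) * cauchyOp a ζ ^ n * a ζ‖ ≤
        ((n + 1 : ℕ) : ℝ) * (opBound * K) ^ n * K := fun ζ => by
      rw [norm_mul, norm_mul, norm_pow, norm_natCast]
      gcongr
      · exact hb ζ
      · exact hK ζ
    have hm1 : Measurable fun ζ => ((n + 1 : ℕ) : ℂ) * cauchyOp a ζ ^ n * a ζ := by fun_prop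
    rw [pow_succ, ih z, cauchyOp_mul hm1 hb1 ha hK]
    congr 1
    ext ζ
    rw [← ih ζ]
    push_cast
    ring

lemma polynomial_cauchyOp (ha : Measurable a) (hK : ∀ ζ, ‖a ζ‖ ≤ K) (p : Polynomial ℂ) (z : ℂ) :
    p.eval (cauchyOp a z) =
      p.eval 0 + cauchyOp (fun ζ => p.derivative.eval (cauchyOp a ζ) * a ζ) z := by
  have hc := continuous_cauchyOp ha hK
  have hm := hc.measurable
  have hb := norm_cauchyOp_le ha hK
  have hB : 0 ≤ opBound * K := (norm_nonneg _).trans (hb 0)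
  have hbound : ∀ q : Polynomial ℂ, ∃ L, ∀ ζ, ‖q.eval (cauchyOp a ζ) * a ζ‖ ≤ L := fun q => by
    obtain ⟨L, hL⟩ := (isCompact_closedBall (0 : ℂ) (opBound * K)).exists_bound_of_continuousOn
      q.continuous.continuousOn
    refine ⟨L * K, fun ζ => ?_⟩
    have h1 := hL (cauchyOp a ζ) (by simpa using hb ζ)
    rw [norm_mul]
    exact mul_le_mul h1 (hK ζ) (norm_nonneg _) ((norm_nonneg _).trans h1)
  have hmeas : ∀ q : Polynomial ℂ, Measurable fun ζ => q.eval (cauchyOp a ζ) * a ζ := fun q =>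
    (q.continuous.measurable.comp hm).mul ha
  induction p using Polynomial.induction_on' with
  | add p q hp hq =>
    obtain ⟨L1, h1⟩ := hbound p.derivative
    obtain ⟨L2, h2⟩ := hbound q.derivative
    simp only [Polynomial.eval_add, Polynomial.derivative_add, add_mul]
    rw [cauchyOp_add (hmeas _) h1 (hmeas _) h2, hp, hq]
    ring
  | monomial n c =>
    cases n with
    | zero => simpa using (cauchyOp_const_mul 0 (fun _ => 0) z)
    | succ n =>
      simp only [Polynomial.eval_monomial, Polynomial.derivative_monomial, Nat.add_sub_cancel]
      rw [pow_cauchyOp ha hK n z, ← cauchyOp_const_mul]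
      simp only [ne_eq, Nat.succ_ne_zero, not_false_eq_true, zero_pow, mul_zero, zero_add]
      congr 1
      ext ζ
      ring

lemma comp_cauchyOp (ha : Measurable a) (hK : ∀ ζ, ‖a ζ‖ ≤ K) {f : ℂ → ℂ} {ρ R : ℝ} (hR : ρ < R)
    (hρ : ∀ ζ, ‖cauchyOp a ζ‖ ≤ ρ) (hf : DifferentiableOn ℂ f (ball 0 R)) (z : ℂ) :
    f (cauchyOp a z) = f 0 + cauchyOp (fun ζ => deriv f (cauchyOp a ζ) * a ζ) z := by
  have hK0 : 0 ≤ K := (norm_nonneg _).trans (hK 0)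
  have hc := continuous_cauchyOp ha hK
  have hmem : ∀ ζ, cauchyOp a ζ ∈ closedBall (0 : ℂ) ρ := fun ζ => by simpa using hρ ζ
  have h0 : (0 : ℂ) ∈ closedBall (0 : ℂ) ρ := by simpa using (norm_nonneg _).trans (hρ 0)
  have hdc : ContinuousOn (deriv f) (closedBall 0 ρ) :=
    ((hf.deriv isOpen_ball).continuousOn).mono (closedBall_subset_ball hR)
  have hdm : Continuous fun ζ => deriv f (cauchyOp a ζ) := hdc.comp_continuous hc hmem
  obtain ⟨L, hL⟩ := (isCompact_closedBall (0 : ℂ) ρ).exists_bound_of_continuousOn hdc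
  have hL0 : 0 ≤ L := (norm_nonneg _).trans (hL 0 h0)
  have hm1 : Measurable fun ζ => deriv f (cauchyOp a ζ) * a ζ := hdm.measurable.mul ha
  have hb1 : ∀ ζ, ‖deriv f (cauchyOp a ζ) * a ζ‖ ≤ L * K := fun ζ => by
    rw [norm_mul]; gcongr
    · exact hL _ (hmem ζ)
    · exact hK ζ
  rw [← sub_eq_zero, ← norm_eq_zero]
  refine le_antisymm (le_of_forall_pos_le_add fun ε hε => ?_) (norm_nonneg _)
  have hO := opBound_nonneg
  have hD : 0 < 2 + opBound * K := by positivity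
  set η := ε / (2 + opBound * K) with hη
  have hη0 : 0 < η := by positivity
  obtain ⟨p, hp⟩ := exists_polynomial_approx_deriv hR hf hη0
  have hm2 : Measurable fun ζ => p.derivative.eval (cauchyOp a ζ) * a ζ :=
    (p.derivative.continuous.comp hc).measurable.mul ha
  have hdiff : ∀ ζ, ‖deriv f (cauchyOp a ζ) * a ζ - p.derivative.eval (cauchyOp a ζ) * a ζ‖ ≤
      η * K := fun ζ => by
    rw [← sub_mul, norm_mul]; gcongr
    · exact (hp _ (hmem ζ)).2
    · exact hK ζ
  have hb2 : ∀ ζ, ‖p.derivative.eval (cauchyOp a ζ) * a ζ‖ ≤ η * K + L * K := fun ζ => by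
    have h1 := norm_sub_norm_le (p.derivative.eval (cauchyOp a ζ) * a ζ)
      (deriv f (cauchyOp a ζ) * a ζ)
    rw [norm_sub_rev] at h1
    linarith [hdiff ζ, hb1 ζ]
  have h1 := norm_cauchyOp_le (hm1.sub hm2) hdiff z
  have h2 : cauchyOp ((fun ζ => deriv f (cauchyOp a ζ) * a ζ) -
      fun ζ => p.derivative.eval (cauchyOp a ζ) * a ζ) z = _ := cauchyOp_sub hm1 hb1 hm2 hb2 z
  rw [h2] at h1
  have h3 := polynomial_cauchyOp ha hK p z
  have h4 := (hp _ (hmem z)).1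
  have h5 := (hp 0 h0).1
  have e : f (cauchyOp a z) - (f 0 + cauchyOp (fun ζ => deriv f (cauchyOp a ζ) * a ζ) z) =
      (f (cauchyOp a z) - p.eval (cauchyOp a z)) - (f 0 - p.eval 0) -
      (cauchyOp (fun ζ => deriv f (cauchyOp a ζ) * a ζ) z -
        cauchyOp (fun ζ => p.derivative.eval (cauchyOp a ζ) * a ζ) z) := by
    rw [h3]; ring
  rw [e, zero_add]
  refine (norm_sub_le _ _).trans ((add_le_add (norm_sub_le _ _) h1).trans ?_)
  have : ε = η * (2 + opBound * K) := by rw [hη]; field_simp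
  rw [this]
  nlinarith

lemma exp_cauchyOp (ha : Measurable a) (hK : ∀ ζ, ‖a ζ‖ ≤ K) (z : ℂ) :
    exp (cauchyOp a z) = 1 + cauchyOp (fun ζ => exp (cauchyOp a ζ) * a ζ) z := by
  have h := comp_cauchyOp ha hK (lt_add_one _) (norm_cauchyOp_le ha hK)
    differentiable_exp.differentiableOn z
  simpa using h

end CauchyTransformComp

section ContinuityMethod
open MeasureTheory Filter Topology

/-- The continuity method for Lipschitz perturbations of the identity. -/
lemma surjective_sub_of_apriori {X : Type*} [NormedAddCommGroup X] [NormedSpace ℝ X]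
    [CompleteSpace X] {G : X → X} {K C : ℝ} (hC : 0 ≤ C)
    (hG : ∀ g₁ g₂, ‖G g₁ - G g₂‖ ≤ K * ‖g₁ - g₂‖)
    (hap : ∀ t ∈ Icc (0 : ℝ) 1, ∀ g₁ g₂,
      ‖g₁ - g₂‖ ≤ C * ‖(g₁ - t • G g₁) - (g₂ - t • G g₂)‖) :
    Function.Surjective fun g => g - G g := by
  obtain ⟨N, hN⟩ := exists_nat_gt (max 0 (C * K))
  have hN0 : (0 : ℝ) < N := (le_max_left _ _).trans_lt hN
  have hNK : C * K < N := (le_max_right _ _).trans_lt hN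
  have key : ∀ k : ℕ, k ≤ N → Function.Surjective fun g => g - ((k : ℝ) / N) • G g := by
    intro k
    induction k with
    | zero => exact fun _ y => ⟨y, by simp⟩
    | succ k ih =>
      intro hk y
      have hs := ih (by omega)
      set t : ℝ := (k : ℝ) / N with ht
      have ht1 : t ∈ Icc (0 : ℝ) 1 := by
        refine ⟨by positivity, ?_⟩
        rw [ht, div_le_one hN0]
        exact_mod_cast (by omega : k ≤ N)
      choose R hR using hs
      simp only at hR
      have hRL : ∀ y₁ y₂, ‖R y₁ - R y₂‖ ≤ C * ‖y₁ - y₂‖ := fun y₁ y₂ => by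
        have := hap t ht1 (R y₁) (R y₂)
        rwa [hR, hR] at this
      set q : ℝ := max 0 (C * K) / N with hq
      have hq0 : 0 ≤ q := by positivity
      have hq1 : q < 1 := by rwa [hq, div_lt_one hN0]
      have hcon : ContractingWith ⟨q, hq0⟩ fun g => R (y + (1 / N : ℝ) • G g) := by
        refine ⟨by exact_mod_cast hq1, LipschitzWith.of_dist_le_mul fun g₁ g₂ => ?_⟩
        rw [dist_eq_norm, dist_eq_norm]
        refine (hRL _ _).trans ?_
        rw [add_sub_add_left_eq_sub, ← smul_sub, norm_smul, Real.norm_of_nonneg (by positivity)]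
        have h1 := hG g₁ g₂
        have h2 : C * K ≤ max 0 (C * K) := le_max_right _ _
        calc C * (1 / N * ‖G g₁ - G g₂‖) ≤ C * (1 / N * (K * ‖g₁ - g₂‖)) := by gcongr
          _ = C * K / N * ‖g₁ - g₂‖ := by ring
          _ ≤ q * ‖g₁ - g₂‖ := by rw [hq]; gcongr
      refine ⟨ContractingWith.fixedPoint _ hcon, ?_⟩
      have hfix := hcon.fixedPoint_isFixedPt
      set g := ContractingWith.fixedPoint _ hcon
      have h1 : R (y + (1 / N : ℝ) • G g) = g := hfix
      have h2 := hR (y + (1 / N : ℝ) • G g)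
      rw [h1] at h2
      have h3 : (((k + 1 : ℕ) : ℝ) / N) = t + 1 / N := by rw [ht]; push_cast; ring
      simp only
      rw [h3, add_smul, ← sub_sub, h2, add_sub_cancel_right]
  have := key N le_rfl
  rw [div_self hN0.ne'] at this
  simpa using this

variable {A h u : ℂ → ℂ} {L H U : ℝ}

lemma exp_neg_cauchyOp (hA : Measurable A) (hL : ∀ ζ, ‖A ζ‖ ≤ L) (z : ℂ) :
    cauchyOp (fun ζ => A ζ * exp (-cauchyOp A ζ)) z = 1 - exp (-cauchyOp A z) := by
  have e1 : ∀ z, cauchyOp (fun ζ => -1 * A ζ) z = -cauchyOp A z := fun z => by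
    rw [cauchyOp_const_mul]; ring
  have h1 := exp_cauchyOp (hA.const_mul (-1)) (fun ζ => by simpa using hL ζ) z
  simp only [e1] at h1
  have e2 : (fun ζ => exp (-cauchyOp A ζ) * (-1 * A ζ)) =
      fun ζ => -1 * (A ζ * exp (-cauchyOp A ζ)) := by ext; ring
  rw [e2, cauchyOp_const_mul] at h1
  rw [h1]; ring

lemma norm_exp_le_of_norm_le {w : ℂ} {x : ℝ} (hw : ‖w‖ ≤ x) : ‖exp w‖ ≤ Real.exp x := by
  rw [norm_exp]
  exact Real.exp_le_exp.2 ((re_le_norm w).trans hw)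

/-- Variation of constants for the linear equation `u = h + cauchyOp (A * u)`. -/
lemma cauchyOp_linear_solution (hA : Measurable A) (hL : ∀ ζ, ‖A ζ‖ ≤ L)
    (hu : Measurable u) (hU : ∀ ζ, ‖u ζ‖ ≤ U)
    (hm : Measurable h) (hH : ∀ ζ, ‖h ζ‖ ≤ H)
    (heq : ∀ z, u z = h z + cauchyOp (fun ζ => A ζ * u ζ) z) (z : ℂ) :
    u z = h z + exp (cauchyOp A z) *
      cauchyOp (fun ζ => A ζ * exp (-cauchyOp A ζ) * h ζ) z := by
  have hL0 : 0 ≤ L := (norm_nonneg _).trans (hL 0)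
  have hH0 : 0 ≤ H := (norm_nonneg _).trans (hH 0)
  have hc := continuous_cauchyOp hA hL
  have hcm := hc.measurable
  have hEb : ∀ ζ, ‖exp (-cauchyOp A ζ)‖ ≤ Real.exp (opBound * L) := fun ζ =>
    norm_exp_le_of_norm_le (by rw [norm_neg]; exact norm_cauchyOp_le hA hL ζ)
  have m1 : Measurable fun ζ => A ζ * u ζ := hA.mul hu
  have b1 : ∀ ζ, ‖A ζ * u ζ‖ ≤ L * U := fun ζ => by
    rw [norm_mul]; gcongr
    · exact hL ζ
    · exact hU ζ
  have m2 : Measurable fun ζ => A ζ * exp (-cauchyOp A ζ) := by fun_prop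
  have b2 : ∀ ζ, ‖A ζ * exp (-cauchyOp A ζ)‖ ≤ L * Real.exp (opBound * L) := fun ζ => by
    rw [norm_mul]; gcongr
    · exact hL ζ
    · exact hEb ζ
  have m3 : Measurable fun ζ => A ζ * exp (-cauchyOp A ζ) * h ζ := by fun_prop
  have b3 : ∀ ζ, ‖A ζ * exp (-cauchyOp A ζ) * h ζ‖ ≤ L * Real.exp (opBound * L) * H := fun ζ => by
    rw [norm_mul]; gcongr
    · exact b2 ζ
    · exact hH ζ
  have h1 := cauchyOp_mul m1 b1 m2 b2 z
  have e1 : (fun ζ => A ζ * u ζ * cauchyOp (fun ζ => A ζ * exp (-cauchyOp A ζ)) ζ +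
      A ζ * exp (-cauchyOp A ζ) * cauchyOp (fun ζ => A ζ * u ζ) ζ) =
      fun ζ => A ζ * u ζ - A ζ * exp (-cauchyOp A ζ) * h ζ := by
    ext ζ
    rw [exp_neg_cauchyOp hA hL, eq_sub_of_add_eq' (heq ζ).symm]
    ring
  rw [e1, cauchyOp_sub m1 b1 m3 b3, exp_neg_cauchyOp hA hL, eq_sub_of_add_eq' (heq z).symm] at h1
  have h2 : cauchyOp (fun ζ => A ζ * exp (-cauchyOp A ζ) * h ζ) z =
      (u z - h z) * exp (-cauchyOp A z) := by linear_combination h1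
  rw [h2, mul_comm (u z - h z), ← mul_assoc, ← exp_add]
  simp

lemma norm_le_of_cauchyOp_linear (hA : Measurable A) (hL : ∀ ζ, ‖A ζ‖ ≤ L)
    (hu : Measurable u) (hU : ∀ ζ, ‖u ζ‖ ≤ U)
    (hm : Measurable h) (hH : ∀ ζ, ‖h ζ‖ ≤ H)
    (heq : ∀ z, u z = h z + cauchyOp (fun ζ => A ζ * u ζ) z) (z : ℂ) :
    ‖u z‖ ≤ (1 + Real.exp (opBound * L) * (opBound * (L * Real.exp (opBound * L)))) * H := by
  have hL0 : 0 ≤ L := (norm_nonneg _).trans (hL 0)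
  have hO := opBound_nonneg
  have hcm := (continuous_cauchyOp hA hL).measurable
  rw [cauchyOp_linear_solution hA hL hu hU hm hH heq z]
  have b3 : ∀ ζ, ‖A ζ * exp (-cauchyOp A ζ) * h ζ‖ ≤ L * Real.exp (opBound * L) * H := fun ζ => by
    rw [norm_mul, norm_mul]; gcongr
    · exact hL ζ
    · exact norm_exp_le_of_norm_le (by rw [norm_neg]; exact norm_cauchyOp_le hA hL ζ)
    · exact hH ζ
  have h1 := norm_cauchyOp_le (by fun_prop) b3 z
  have h2 := norm_exp_le_of_norm_le (norm_cauchyOp_le hA hL z)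
  refine (norm_add_le _ _).trans ?_
  rw [norm_mul]
  have h3 := mul_le_mul h2 h1 (norm_nonneg _) (Real.exp_pos _).le
  have h4 := hH z
  linarith

lemma cauchyOp_linear_const {c : ℂ} (hA : Measurable A) (hL : ∀ ζ, ‖A ζ‖ ≤ L)
    (hu : Measurable u) (hU : ∀ ζ, ‖u ζ‖ ≤ U)
    (heq : ∀ z, u z = c + cauchyOp (fun ζ => A ζ * u ζ) z) (z : ℂ) :
    u z = c * exp (cauchyOp A z) := by
  have h1 := cauchyOp_linear_solution hA hL hu hU (measurable_const (a := c))
    (fun _ => le_rfl) heq z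
  have e : (fun ζ => A ζ * exp (-cauchyOp A ζ) * c) =
      fun ζ => c * (A ζ * exp (-cauchyOp A ζ)) := by ext; ring
  rw [e, cauchyOp_const_mul, exp_neg_cauchyOp hA hL] at h1
  have h2 : exp (cauchyOp A z) * exp (-cauchyOp A z) = 1 := by rw [← exp_add]; simp
  rw [h1]
  linear_combination -c * h2

end ContinuityMethod

section NonlinearEquation
open MeasureTheory Filter Topology
open scoped BoundedContinuousFunction

variable {Ψ : ℂ → ℂ → ℂ} {L M : ℝ}

lemma norm_differenceQuotient_le (hL0 : 0 ≤ L)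
    (hL : ∀ ζ w₁ w₂, ‖Ψ ζ w₁ - Ψ ζ w₂‖ ≤ L * ‖w₁ - w₂‖)
    (ζ w₁ w₂ : ℂ) : ‖(Ψ ζ w₁ - Ψ ζ w₂) / (w₁ - w₂)‖ ≤ L := by
  rw [norm_div]
  exact div_le_of_le_mul₀ (norm_nonneg _) hL0 (hL ζ w₁ w₂)

lemma differenceQuotient_mul (Ψ : ℂ → ℂ → ℂ) (ζ w₁ w₂ : ℂ) :
    (Ψ ζ w₁ - Ψ ζ w₂) / (w₁ - w₂) * (w₁ - w₂) = Ψ ζ w₁ - Ψ ζ w₂ := by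
  rcases eq_or_ne w₁ w₂ with rfl | h
  · simp
  · exact div_mul_cancel₀ _ (sub_ne_zero.2 h)

/-- Solvability of the equation `g = z₀ + cauchyOp (Ψ(·, g))` for bounded `Ψ`, Lipschitz in the
second variable. -/
lemma exists_eq_add_cauchyOp (hm : Measurable (Function.uncurry Ψ)) (hM : ∀ ζ w, ‖Ψ ζ w‖ ≤ M)
    (hL0 : 0 ≤ L) (hL : ∀ ζ w₁ w₂, ‖Ψ ζ w₁ - Ψ ζ w₂‖ ≤ L * ‖w₁ - w₂‖) (z₀ : ℂ) :
    ∃ g : ℂ → ℂ, Continuous g ∧ ∀ z, g z = z₀ + cauchyOp (fun ζ => Ψ ζ (g ζ)) z := by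
  have hms : ∀ g : ℂ →ᵇ ℂ, Measurable fun ζ => Ψ ζ (g ζ) := fun g =>
    hm.comp (measurable_id.prodMk g.continuous.measurable)
  let G : (ℂ →ᵇ ℂ) → (ℂ →ᵇ ℂ) := fun g =>
    BoundedContinuousFunction.ofNormedAddCommGroup (cauchyOp fun ζ => Ψ ζ (g ζ))
      (continuous_cauchyOp (hms g) fun ζ => hM ζ (g ζ)) (opBound * M)
      (norm_cauchyOp_le (hms g) fun ζ => hM ζ (g ζ))
  have hGz : ∀ g z, G g z = cauchyOp (fun ζ => Ψ ζ (g ζ)) z := fun _ _ => rfl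
  have hO := opBound_nonneg
  have hsub : ∀ (g₁ g₂ : ℂ →ᵇ ℂ) z, G g₁ z - G g₂ z =
      cauchyOp (fun ζ => Ψ ζ (g₁ ζ) - Ψ ζ (g₂ ζ)) z := fun g₁ g₂ z => by
    rw [hGz, hGz, cauchyOp_sub (hms g₁) (fun ζ => hM ζ (g₁ ζ)) (hms g₂) (fun ζ => hM ζ (g₂ ζ))]
  have hdb : ∀ (g₁ g₂ : ℂ →ᵇ ℂ) ζ, ‖Ψ ζ (g₁ ζ) - Ψ ζ (g₂ ζ)‖ ≤ L * ‖g₁ - g₂‖ := fun g₁ g₂ ζ =>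
    (hL ζ _ _).trans (by gcongr; exact (g₁ - g₂).norm_coe_le_norm ζ)
  have hlip : ∀ g₁ g₂, ‖G g₁ - G g₂‖ ≤ opBound * L * ‖g₁ - g₂‖ := fun g₁ g₂ => by
    refine (BoundedContinuousFunction.norm_le (by positivity)).2 fun z => ?_
    rw [BoundedContinuousFunction.coe_sub, Pi.sub_apply, hsub, mul_assoc]
    exact norm_cauchyOp_le ((hms g₁).sub (hms g₂)) (hdb g₁ g₂) z
  have hsurj := surjective_sub_of_apriori
    (C := 1 + Real.exp (opBound * L) * (opBound * (L * Real.exp (opBound * L))))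
    (by positivity) hlip fun t ht g₁ g₂ => by
      refine (BoundedContinuousFunction.norm_le (by positivity)).2 fun z => ?_
      have hA : Measurable fun ζ => (t : ℂ) * ((Ψ ζ (g₁ ζ) - Ψ ζ (g₂ ζ)) / (g₁ ζ - g₂ ζ)) := by
        have h1 := hms g₁
        have h2 := hms g₂
        have h3 := g₁.continuous.measurable
        have h4 := g₂.continuous.measurable
        fun_prop
      refine norm_le_of_cauchyOp_linear (L := L) (U := ‖g₁ - g₂‖) hA (fun ζ => ?_)
        (g₁ - g₂).continuous.measurable (fun ζ => (g₁ - g₂).norm_coe_le_norm ζ)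
        ((g₁ - t • G g₁) - (g₂ - t • G g₂)).continuous.measurable
        (fun ζ => BoundedContinuousFunction.norm_coe_le_norm _ ζ) (fun z => ?_) z
      · rw [norm_mul, norm_real, Real.norm_of_nonneg ht.1]
        exact (mul_le_of_le_one_left (norm_nonneg _) ht.2).trans
          (norm_differenceQuotient_le hL0 hL _ _ _)
      · have e : (fun ζ => (t : ℂ) * ((Ψ ζ (g₁ ζ) - Ψ ζ (g₂ ζ)) / (g₁ ζ - g₂ ζ)) * (g₁ - g₂) ζ) =
            fun ζ => (t : ℂ) * (Ψ ζ (g₁ ζ) - Ψ ζ (g₂ ζ)) := by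
          ext ζ
          rw [BoundedContinuousFunction.coe_sub, Pi.sub_apply, mul_assoc,
            differenceQuotient_mul]
        rw [e, cauchyOp_const_mul, ← hsub]
        simp only [BoundedContinuousFunction.coe_sub, Pi.sub_apply,
          BoundedContinuousFunction.coe_smul, real_smul]
        ring
  obtain ⟨g, hg⟩ := hsurj (BoundedContinuousFunction.const ℂ z₀)
  refine ⟨g, g.continuous, fun z => ?_⟩
  have := DFunLike.congr_fun hg z
  simp only [BoundedContinuousFunction.coe_sub, Pi.sub_apply,
    BoundedContinuousFunction.const_apply] at this
  rw [← hGz, ← this]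
  ring

/-- Two solutions of `g = c + cauchyOp (Ψ(·, g))` which differ at the origin differ
everywhere. -/
lemma ne_of_eq_add_cauchyOp (hm : Measurable (Function.uncurry Ψ)) (hM : ∀ ζ w, ‖Ψ ζ w‖ ≤ M)
    (hL0 : 0 ≤ L) (hL : ∀ ζ w₁ w₂, ‖Ψ ζ w₁ - Ψ ζ w₂‖ ≤ L * ‖w₁ - w₂‖) {g₁ g₂ : ℂ → ℂ} {c₁ c₂ : ℂ}
    (hg₁ : Measurable g₁) (hg₂ : Measurable g₂)
    (h₁ : ∀ z, g₁ z = c₁ + cauchyOp (fun ζ => Ψ ζ (g₁ ζ)) z)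
    (h₂ : ∀ z, g₂ z = c₂ + cauchyOp (fun ζ => Ψ ζ (g₂ ζ)) z) (hc : c₁ ≠ c₂) (z : ℂ) :
    g₁ z ≠ g₂ z := by
  have m₁ : Measurable fun ζ => Ψ ζ (g₁ ζ) := hm.comp (measurable_id.prodMk hg₁)
  have m₂ : Measurable fun ζ => Ψ ζ (g₂ ζ) := hm.comp (measurable_id.prodMk hg₂)
  have hA : Measurable fun ζ => (Ψ ζ (g₁ ζ) - Ψ ζ (g₂ ζ)) / (g₁ ζ - g₂ ζ) := by fun_prop
  have hdb : ∀ ζ, ‖Ψ ζ (g₁ ζ) - Ψ ζ (g₂ ζ)‖ ≤ M + M := fun ζ =>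
    (norm_sub_le _ _).trans (add_le_add (hM _ _) (hM _ _))
  have hsub : ∀ z, g₁ z - g₂ z =
      (c₁ - c₂) + cauchyOp (fun ζ => Ψ ζ (g₁ ζ) - Ψ ζ (g₂ ζ)) z := fun z => by
    rw [cauchyOp_sub m₁ (fun ζ => hM _ _) m₂ fun ζ => hM _ _, h₁ z, h₂ z]
    ring
  have hb : ∀ ζ, ‖g₁ ζ - g₂ ζ‖ ≤ ‖c₁ - c₂‖ + opBound * (M + M) := fun ζ => by
    rw [hsub]
    exact (norm_add_le _ _).trans (by gcongr; exact norm_cauchyOp_le (m₁.sub m₂) hdb ζ)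
  have h := cauchyOp_linear_const (u := fun ζ => g₁ ζ - g₂ ζ) (c := c₁ - c₂) hA
    (fun ζ => norm_differenceQuotient_le hL0 hL _ _ _) (hg₁.sub hg₂) hb (fun z => by
      simp only [differenceQuotient_mul]; exact hsub z) z
  exact sub_ne_zero.1 (h ▸ mul_ne_zero (sub_ne_zero.2 hc) (exp_ne_zero _))

end NonlinearEquation

section AvoidingSection
open MeasureTheory Filter Topology

/-- The tent function `x ↦ max (1 - x / δ) 0`. -/
def tent (δ x : ℝ) : ℝ := max (1 - x / δ) 0

lemma tent_mem {δ x : ℝ} (hδ : 0 < δ) (hx : 0 ≤ x) : |tent δ x| ≤ 1 := by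
  have : 0 ≤ x / δ := by positivity
  rw [tent, abs_of_nonneg (le_max_right _ _)]
  exact max_le (by linarith) zero_le_one

lemma abs_tent_sub_le {δ : ℝ} (hδ : 0 < δ) (x y : ℝ) : |tent δ x - tent δ y| ≤ |x - y| / δ := by
  refine (abs_max_sub_max_le_abs _ _ _).trans (le_of_eq ?_)
  have : |x - y| / δ = |(y - x) / δ| := by rw [abs_div, abs_sub_comm, abs_of_pos hδ]
  rw [this]
  congr 1
  ring

lemma tent_of_le {δ x : ℝ} (hδ : 0 < δ) (hx : δ ≤ x) : tent δ x = 0 := by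
  have : 1 ≤ x / δ := (one_le_div hδ).2 hx
  exact max_eq_right (by linarith)

lemma exists_separation {ι : Type*} [Finite ι] {f : ι → ℂ → ℂ} {s : Set ℂ} (hs : IsCompact s)
    (hf : ∀ i, ContinuousOn (f i) s) (hne : ∀ i j, i ≠ j → ∀ z ∈ s, f i z ≠ f j z) :
    ∃ δ : ℝ, 0 < δ ∧ ∀ i j, i ≠ j → ∀ z ∈ s, δ ≤ ‖f i z - f j z‖ := by
  have h : ∀ᶠ δ in 𝓝[>] (0 : ℝ), ∀ i j, i ≠ j → ∀ z ∈ s, δ ≤ ‖f i z - f j z‖ := by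
    refine eventually_all.2 fun i => eventually_all.2 fun j => ?_
    by_cases hij : i = j
    · exact Eventually.of_forall fun δ h => absurd hij h
    obtain rfl | hsne := s.eq_empty_or_nonempty
    · simp
    obtain ⟨x, hx, hmin⟩ := hs.exists_isMinOn hsne ((hf i).sub (hf j)).norm
    have h0 : 0 < ‖f i x - f j x‖ := norm_pos_iff.2 (sub_ne_zero.2 (hne i j hij x hx))
    filter_upwards [Ioo_mem_nhdsGT h0] with δ hδ _ z hz
    exact hδ.2.le.trans (hmin hz)
  obtain ⟨δ, h1, h2⟩ := (h.and self_mem_nhdsWithin).exists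
  exact ⟨δ, h2, h1⟩

/-- A bounded Lipschitz field interpolating the densities `β i` along the separated graphs
`F i`. -/
def tentField {ι : Type*} [Fintype ι] (δ : ℝ) (F β : ι → ℂ → ℂ) (ζ w : ℂ) : ℂ :=
  ∑ i, (tent δ ‖w - F i ζ‖ : ℂ) * β i ζ

section TentField
variable {ι : Type*} [Fintype ι] {δ : ℝ} {F β : ι → ℂ → ℂ} {D : ι → ℝ}

lemma measurable_tentField (hF : ∀ i, Measurable (F i)) (hβ : ∀ i, Measurable (β i)) :
    Measurable (Function.uncurry (tentField δ F β)) := by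
  simp only [Function.uncurry_def, tentField, tent]
  refine Finset.measurable_sum _ fun i _ => ?_
  have h1 := hβ i
  have h2 := hF i
  fun_prop

lemma norm_tentField_le (hδ : 0 < δ) (hβb : ∀ i ζ, ‖β i ζ‖ ≤ D i) (ζ w : ℂ) :
    ‖tentField δ F β ζ w‖ ≤ ∑ i, D i := by
  refine norm_sum_le_of_le _ fun i _ => ?_
  rw [norm_mul, norm_real, Real.norm_eq_abs]
  exact (mul_le_mul (tent_mem hδ (norm_nonneg _)) (hβb i ζ) (norm_nonneg _) zero_le_one).trans
    (one_mul _).le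

lemma norm_tentField_sub_le (hδ : 0 < δ) (hβb : ∀ i ζ, ‖β i ζ‖ ≤ D i) (ζ w₁ w₂ : ℂ) :
    ‖tentField δ F β ζ w₁ - tentField δ F β ζ w₂‖ ≤ (∑ i, D i / δ) * ‖w₁ - w₂‖ := by
  rw [tentField, tentField, ← Finset.sum_sub_distrib, Finset.sum_mul]
  refine norm_sum_le_of_le _ fun i _ => ?_
  rw [← sub_mul, norm_mul, ← ofReal_sub, norm_real, Real.norm_eq_abs]
  have h1 := abs_tent_sub_le hδ ‖w₁ - F i ζ‖ ‖w₂ - F i ζ‖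
  have h2 := abs_norm_sub_norm_le (w₁ - F i ζ) (w₂ - F i ζ)
  rw [sub_sub_sub_cancel_right] at h2
  calc _ ≤ (‖w₁ - w₂‖ / δ) * D i := by
        refine mul_le_mul (h1.trans (by gcongr)) (hβb i ζ) (norm_nonneg _) (by positivity)
    _ = _ := by ring

lemma tentField_apply (hδ : 0 < δ) (hsep : ∀ i j, i ≠ j → ∀ ζ, δ ≤ ‖F i ζ - F j ζ‖) (i : ι)
    (ζ : ℂ) : tentField δ F β ζ (F i ζ) = β i ζ := by
  rw [tentField, Finset.sum_eq_single i]
  · simp [tent]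
  · intro j _ hj
    rw [tent_of_le hδ (hsep i j hj.symm ζ)]
    simp
  · simp

lemma exists_interpolating_field (hδ : 0 < δ) (hβm : ∀ i, Measurable (β i))
    (hβb : ∀ i ζ, ‖β i ζ‖ ≤ D i) (hFm : ∀ i, Measurable (F i))
    (hsep : ∀ i j, i ≠ j → ∀ ζ, δ ≤ ‖F i ζ - F j ζ‖) :
    ∃ (Ψ : ℂ → ℂ → ℂ) (M L : ℝ), Measurable (Function.uncurry Ψ) ∧ (∀ ζ w, ‖Ψ ζ w‖ ≤ M) ∧ 0 ≤ L ∧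
      (∀ ζ w₁ w₂, ‖Ψ ζ w₁ - Ψ ζ w₂‖ ≤ L * ‖w₁ - w₂‖) ∧ ∀ i ζ, Ψ ζ (F i ζ) = β i ζ :=
  ⟨tentField δ F β, ∑ i, D i, ∑ i, D i / δ, measurable_tentField hFm hβm,
    norm_tentField_le hδ hβb,
    Finset.sum_nonneg fun i _ => div_nonneg ((norm_nonneg _).trans (hβb i 0)) hδ.le,
    norm_tentField_sub_le hδ hβb, tentField_apply hδ hsep⟩

lemma exists_avoiding_of_density (hδ : 0 < δ) (hβm : ∀ i, Measurable (β i))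
    (hβb : ∀ i ζ, ‖β i ζ‖ ≤ D i) (hFm : ∀ i, Measurable (F i)) {c : ι → ℂ}
    (hF : ∀ i z, F i z = c i + cauchyOp (β i) z)
    (hsep : ∀ i j, i ≠ j → ∀ ζ, δ ≤ ‖F i ζ - F j ζ‖) {z₀ : ℂ} (hz₀ : ∀ i, z₀ ≠ c i) :
    ∃ g : ℂ → ℂ, DifferentiableOn ℂ g (ball 0 1) ∧ g 0 = z₀ ∧ ∀ z i, g z ≠ F i z := by
  obtain ⟨Ψ, M, L, hΨm, hΨb, hL0, hΨl, hΨ⟩ := exists_interpolating_field hδ hβm hβb hFm hsep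
  obtain ⟨g, hgc, hg⟩ := exists_eq_add_cauchyOp hΨm hΨb hL0 hΨl z₀
  have hgm : Measurable fun ζ => Ψ ζ (g ζ) :=
    hΨm.comp (measurable_id.prodMk hgc.measurable)
  refine ⟨g, ?_, by rw [hg]; simp, fun z i => ?_⟩
  · have : g = fun z => z₀ + cauchyOp (fun ζ => Ψ ζ (g ζ)) z := funext hg
    rw [this]
    exact (differentiableOn_cauchyOp hgm fun ζ => hΨb ζ _).const_add _
  · exact ne_of_eq_add_cauchyOp hΨm hΨb hL0 hΨl hgc.measurable (hFm i)
      hg (fun z => by simp only [hΨ]; exact hF i z) (hz₀ i) z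

end TentField

/-- A finite disjoint family of holomorphic graphs over a disk of radius `ρ > 1` can be completed
by a holomorphic graph over the unit disk through a given point over the origin. -/
lemma exists_avoiding_of_one_lt {ι : Type*} [Finite ι] {f : ι → ℂ → ℂ} {ρ : ℝ} (hρ : 1 < ρ)
    (hf : ∀ i, DifferentiableOn ℂ (f i) (ball 0 ρ))
    (hne : ∀ i j, i ≠ j → ∀ z ∈ ball (0 : ℂ) ρ, f i z ≠ f j z)
    {z₀ : ℂ} (hz₀ : ∀ i, z₀ ≠ f i 0) :
    ∃ g : ℂ → ℂ, DifferentiableOn ℂ g (ball 0 1) ∧ g 0 = z₀ ∧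
      ∀ z ∈ ball (0 : ℂ) 1, ∀ i, g z ≠ f i z := by
  cases nonempty_fintype ι
  have hsub : closedBall (0 : ℂ) 1 ⊆ ball 0 ρ := closedBall_subset_ball hρ
  obtain ⟨δ, hδ, hsep⟩ := exists_separation (isCompact_closedBall (0 : ℂ) 1)
    (fun i => (hf i).continuousOn.mono hsub) fun i j hij z hz => hne i j hij z (hsub hz)
  have hlc : Continuous (cauchyOp retractDensity) :=
    continuous_cauchyOp measurable_retractDensity norm_retractDensity_le
  have hlm : ∀ ζ, cauchyOp retractDensity ζ ∈ closedBall (0 : ℂ) 1 := fun ζ => by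
    simpa using norm_cauchyOp_retractDensity_le ζ
  have hdc : ∀ i, ContinuousOn (deriv (f i)) (closedBall 0 1) := fun i =>
    (((hf i).deriv isOpen_ball).continuousOn).mono hsub
  choose D hD using fun i => (isCompact_closedBall (0 : ℂ) 1).exists_bound_of_continuousOn (hdc i)
  have hD0 : ∀ i, 0 ≤ D i := fun i => (norm_nonneg _).trans (hD i 0 (by simp))
  obtain ⟨g, hg, hg0, hgne⟩ := exists_avoiding_of_density hδ
    (F := fun i ζ => f i (cauchyOp retractDensity ζ))
    (β := fun i ζ => deriv (f i) (cauchyOp retractDensity ζ) * retractDensity ζ)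
    (fun i => ((hdc i).comp_continuous hlc hlm).measurable.mul measurable_retractDensity)
    (fun i ζ => by
      rw [norm_mul]
      exact (mul_le_mul (hD i _ (hlm ζ)) (norm_retractDensity_le ζ) (norm_nonneg _)
        (hD0 i)).trans (mul_one _).le)
    (fun i => (((hf i).continuousOn.mono hsub).comp_continuous hlc hlm).measurable)
    (fun i z => comp_cauchyOp measurable_retractDensity norm_retractDensity_le hρ
      norm_cauchyOp_retractDensity_le (hf i) z)
    (fun i j hij ζ => hsep i j hij _ (hlm ζ)) hz₀
  refine ⟨g, hg, hg0, fun z hz i => ?_⟩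
  have h := hgne z i
  rwa [cauchyOp_retractDensity_of_mem hz] at h

end AvoidingSection

section Lifting
open Filter Topology

variable {r : ℝ}

lemma eq_exp_of_hasDerivAt {u g p : ℂ → ℂ} (hu : ∀ z ∈ ball (0 : ℂ) r, HasDerivAt u (p z * u z) z)
    (hg : ∀ z ∈ ball (0 : ℂ) r, HasDerivAt g (p z) z) (h0 : u 0 = exp (g 0))
    {z : ℂ} (hz : z ∈ ball (0 : ℂ) r) : u z = exp (g z) := by
  have hr : 0 < r := pos_of_mem_ball hz
  have h1 : ∀ w ∈ ball (0 : ℂ) r, HasDerivAt (fun w => u w * exp (-g w)) 0 w := fun w hw => by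
    refine ((hu w hw).mul (hg w hw).neg.cexp).congr_deriv ?_
    simp only [Pi.neg_apply]
    ring
  have h2 := (convex_ball (0 : ℂ) r).norm_image_sub_le_of_norm_deriv_le (C := 0)
    (fun w hw => (h1 w hw).differentiableAt) (fun w hw => by rw [(h1 w hw).deriv, norm_zero])
    (mem_ball_self hr) hz
  rw [zero_mul, norm_le_zero_iff, sub_eq_zero, h0, ← exp_add, add_neg_cancel, exp_zero] at h2
  have h3 : exp (-g z) * exp (g z) = 1 := by rw [← exp_add]; simp
  calc u z = u z * exp (-g z) * exp (g z) := by rw [mul_assoc, h3, mul_one]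
    _ = exp (g z) := by rw [h2, one_mul]

lemma exists_log_lift {q : ℂ → ℂ} (hr : 0 < r) (hq : DifferentiableOn ℂ q (ball 0 r))
    (h0 : ∀ z ∈ ball (0 : ℂ) r, q z ≠ 0) :
    ∃ g : ℂ → ℂ, DifferentiableOn ℂ g (ball 0 r) ∧ ∀ z ∈ ball (0 : ℂ) r, q z = exp (g z) := by
  have hd : DifferentiableOn ℂ (fun z => deriv q z / q z) (ball 0 r) :=
    (hq.deriv isOpen_ball).div hq h0
  obtain ⟨g, hg0, hg⟩ := hd.isExactOn_ball.with_val_at 0 (log (q 0))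
  refine ⟨g, fun z hz => (hg z hz).differentiableAt.differentiableWithinAt, fun z hz => ?_⟩
  refine eq_exp_of_hasDerivAt (p := fun z => deriv q z / q z) (fun w hw => ?_) hg ?_ hz
  · rw [div_mul_cancel₀ _ (h0 w hw)]
    exact (hq.differentiableAt (isOpen_ball.mem_nhds hw)).hasDerivAt
  · rw [hg0, exp_log (h0 0 (mem_ball_self hr))]

lemma exists_sqrt_lift {q : ℂ → ℂ} (hr : 0 < r) (hq : DifferentiableOn ℂ q (ball 0 r))
    (h0 : ∀ z ∈ ball (0 : ℂ) r, q z ≠ 0) {s₀ : ℂ} (hs₀ : s₀ ^ 2 = q 0) :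
    ∃ s : ℂ → ℂ, DifferentiableOn ℂ s (ball 0 r) ∧ s 0 = s₀ ∧
      ∀ z ∈ ball (0 : ℂ) r, s z ^ 2 = q z := by
  obtain ⟨g, hg, hgq⟩ := exists_log_lift hr hq h0
  have hsq : ∀ z ∈ ball (0 : ℂ) r, exp (g z / 2) ^ 2 = q z := fun z hz => by
    rw [hgq z hz, ← exp_nat_mul]; congr 1; push_cast; ring
  have hd : DifferentiableOn ℂ (fun z => exp (g z / 2)) (ball 0 r) := (hg.div_const 2).cexp
  rcases sq_eq_sq_iff_eq_or_eq_neg.1 (hs₀.trans (hsq 0 (mem_ball_self hr)).symm) with h | h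
  · exact ⟨_, hd, h.symm, hsq⟩
  · exact ⟨_, hd.neg, h.symm, fun z hz => by rw [Pi.neg_apply, neg_sq, hsq z hz]⟩

/-- A holomorphic function on a disk omitting `±1` factors through the cosine. -/
lemma exists_cos_lift {f : ℂ → ℂ} (hr : 0 < r) (hf : DifferentiableOn ℂ f (ball 0 r))
    (h1 : ∀ z ∈ ball (0 : ℂ) r, f z ≠ 1) (h2 : ∀ z ∈ ball (0 : ℂ) r, f z ≠ -1)
    {w₀ : ℂ} (hw₀ : cos w₀ = f 0) :
    ∃ F : ℂ → ℂ, DifferentiableOn ℂ F (ball 0 r) ∧ F 0 = w₀ ∧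
      ∀ z ∈ ball (0 : ℂ) r, f z = cos (F z) := by
  obtain ⟨s, hs, hs0, hsq⟩ := exists_sqrt_lift (q := fun z => 1 - f z ^ 2) hr
    ((hf.pow 2).const_sub 1)
    (fun z hz h => by
      have : (1 - f z) * (1 + f z) = 0 := by linear_combination h
      rcases mul_eq_zero.1 this with h | h
      · exact h1 z hz (by linear_combination -h)
      · exact h2 z hz (by linear_combination h))
    (s₀ := sin w₀) (by rw [← hw₀]; linear_combination sin_sq_add_cos_sq w₀)
  have hsne : ∀ z ∈ ball (0 : ℂ) r, s z ≠ 0 := fun z hz h => by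
    have h3 := hsq z hz
    rw [h] at h3
    have : (1 - f z) * (1 + f z) = 0 := by linear_combination -h3
    rcases mul_eq_zero.1 this with h | h
    · exact h1 z hz (by linear_combination -h)
    · exact h2 z hz (by linear_combination h)
  have hfd : ∀ z ∈ ball (0 : ℂ) r, HasDerivAt f (deriv f z) z := fun z hz =>
    (hf.differentiableAt (isOpen_ball.mem_nhds hz)).hasDerivAt
  have hsd : ∀ z ∈ ball (0 : ℂ) r, HasDerivAt s (-(f z * deriv f z / s z)) z := fun z hz => by
    have h3 := (hs.differentiableAt (isOpen_ball.mem_nhds hz)).hasDerivAt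
    have h4 := ((hfd z hz).pow 2).const_sub 1
    have h5 := (h3.pow 2).congr_of_eventuallyEq (f₁ := fun z => 1 - f z ^ 2)
      (by filter_upwards [isOpen_ball.mem_nhds hz] with w hw using (hsq w hw).symm)
    have h6 := h4.unique h5
    have h7 : deriv s z = -(f z * deriv f z / s z) := by
      have := hsne z hz
      field_simp
      push_cast at h6
      linear_combination -(1 / 2) * h6
    rwa [h7] at h3
  have hd : DifferentiableOn ℂ (fun z => -(deriv f z / s z)) (ball 0 r) :=
    ((hf.deriv isOpen_ball).div hs hsne).neg
  obtain ⟨F, hF0, hF⟩ := hd.isExactOn_ball.with_val_at 0 w₀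
  refine ⟨F, fun z hz => (hF z hz).differentiableAt.differentiableWithinAt, hF0, fun z hz => ?_⟩
  have hexp : ∀ ε : ℂ, ε ^ 2 = -1 → f z + ε * s z = exp (ε * F z) := fun ε hε => by
    refine eq_exp_of_hasDerivAt (u := fun z => f z + ε * s z) (g := fun z => ε * F z)
      (p := fun z => ε * -(deriv f z / s z)) (fun w hw => ?_)
      (fun w hw => (hF w hw).const_mul ε) ?_ hz
    · refine ((hfd w hw).add ((hsd w hw).const_mul ε)).congr_deriv ?_
      have := hsne w hw
      field_simp
      linear_combination (deriv f w * s w) * hε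
    · simp only [hF0, hs0, ← hw₀]
      have : ε = I ∨ ε = -I := sq_eq_sq_iff_eq_or_eq_neg.1 (by rw [hε, I_sq])
      rcases this with rfl | rfl
      · rw [mul_comm I w₀, exp_mul_I]; ring
      · have e : -I * w₀ = -w₀ * I := by ring
        rw [e, exp_mul_I, cos_neg, sin_neg]; ring
  have h3 := hexp I I_sq
  have h4 := hexp (-I) (by rw [neg_sq, I_sq])
  rw [cos, mul_comm (F z) I, mul_comm _ I, mul_neg, ← neg_mul, ← h3, ← h4]
  ring

end Lifting

section Schottky
open Filter Topology

/-- A quantitative form of the Bloch theorem. -/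
lemma norm_deriv_mul_le_of_not_ball_subset {G : ℂ → ℂ} {ρ R : ℝ} (hρ : ρ < 1)
    (hG : DifferentiableOn ℂ G (ball 0 1)) (hR : ∀ c, ¬ ball c R ⊆ G '' ball 0 1)
    {z : ℂ} (hz : z ∈ closedBall (0 : ℂ) ρ) : ‖deriv G z‖ * (ρ - ‖z‖) ≤ 64 * R := by
  have hρ1 : closedBall (0 : ℂ) ρ ⊆ ball 0 1 := closedBall_subset_ball hρ
  have hG' : DifferentiableOn ℂ (deriv G) (ball 0 1) := hG.deriv isOpen_ball
  have hcont : ContinuousOn (fun z => ‖deriv G z‖ * (ρ - ‖z‖)) (closedBall 0 ρ) :=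
    ((hG'.continuousOn.mono hρ1).norm).mul (continuousOn_const.sub continuous_norm.continuousOn)
  obtain ⟨a, ha, hmax⟩ := (isCompact_closedBall (0 : ℂ) ρ).exists_isMaxOn ⟨z, hz⟩ hcont
  refine (hmax hz).trans ?_
  simp only
  by_contra! hlt
  have hRn : 0 ≤ R := by
    by_contra! h
    exact hR 0 (by rw [ball_eq_empty.2 h.le]; exact empty_subset _)
  set D := ‖deriv G a‖ with hD
  obtain ⟨t, ht⟩ : ∃ t, t = (ρ - ‖a‖) / 2 := ⟨_, rfl⟩
  have haρ : ‖a‖ ≤ ρ := by simpa using ha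
  have ht2 : ρ - ‖a‖ = 2 * t := by rw [ht]; ring
  rw [ht2] at hlt
  have hD0 : 0 ≤ D := norm_nonneg _
  have ht0 : 0 < t := by
    rcases (show 0 ≤ t by linarith).eq_or_lt with h | h
    · rw [← h] at hlt; linarith
    · exact h
  have hDpos : 0 < D := by
    rcases hD0.eq_or_lt with h | h
    · rw [← h] at hlt; linarith
    · exact h
  have hsub : closedBall a t ⊆ closedBall 0 ρ := closedBall_subset_closedBall' (by
    rw [dist_zero_right]; linarith)
  have hbd : ∀ w ∈ ball a t, ‖deriv G w‖ ≤ 2 * D := fun w hw => by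
    have h1 := hmax (hsub (ball_subset_closedBall hw))
    simp only [mem_ofPred_eq, ← hD, ht2] at h1
    have h2 : ‖w‖ ≤ ‖a‖ + t := by
      have := norm_le_norm_add_norm_sub' w a
      have h3 : ‖w - a‖ < t := by simpa [dist_eq_norm] using hw
      linarith
    have h3 : ‖deriv G w‖ * t ≤ ‖deriv G w‖ * (ρ - ‖w‖) :=
      mul_le_mul_of_nonneg_left (by linarith) (norm_nonneg _)
    have h4 : ‖deriv G w‖ * t ≤ 2 * D * t := by linarith
    exact le_of_mul_le_mul_right h4 ht0
  have hbt : ball a t ⊆ ball 0 1 := ball_subset_closedBall.trans (hsub.trans hρ1)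
  have hschw : ∀ w ∈ ball a t, ‖deriv G w - deriv G a‖ ≤ 4 * D / t * ‖w - a‖ := fun w hw => by
    have h := Complex.dist_le_div_mul_dist_of_mapsTo_ball (R₂ := 4 * D) (hG'.mono hbt)
      (fun w hw => ?_) hw
    · simpa [dist_eq_norm] using h
    · rw [mem_closedBall, dist_eq_norm]
      refine (norm_sub_le _ _).trans ?_
      have := hbd w hw
      linarith
  have hs : t / 8 < t := by linarith
  have hcb : closedBall a (t / 8) ⊆ ball a t := closedBall_subset_ball hs
  have hlin : ∀ w ∈ sphere a (t / 8), D * (t / 8) / 2 ≤ ‖G w - G a‖ := fun w hw => by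
    have h1 := (convex_closedBall a (t / 8)).norm_image_sub_le_of_norm_deriv_le
      (f := fun w => G w - deriv G a * w) (C := D / 2) (x := a) (y := w)
      (fun x hx => ((hG.differentiableAt (isOpen_ball.mem_nhds (hbt (hcb hx))))).sub
        (differentiableAt_id.const_mul _))
      (fun x hx => by
        have h2 := (hG.differentiableAt (isOpen_ball.mem_nhds (hbt (hcb hx)))).hasDerivAt
        have h3 := (h2.sub ((hasDerivAt_id x).const_mul (deriv G a))).deriv
        simp only [mul_one] at h3
        have h4 : deriv (fun w => G w - deriv G a * w) x = deriv G x - deriv G a := h3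
        rw [h4]
        refine (hschw x (hcb hx)).trans ?_
        have h5 : ‖x - a‖ ≤ t / 8 := by simpa [dist_eq_norm] using hx
        calc 4 * D / t * ‖x - a‖ ≤ 4 * D / t * (t / 8) := by gcongr
          _ = D / 2 := by field_simp; norm_num)
      (mem_closedBall_self (by linarith)) (sphere_subset_closedBall hw)
    have h6 : ‖w - a‖ = t / 8 := by simpa [dist_eq_norm] using hw
    rw [h6] at h1
    have h7 : deriv G a * (w - a) =
        (G w - G a) - (G w - deriv G a * w - (G a - deriv G a * a)) := by
      ring
    have h8 : D * (t / 8) ≤ ‖G w - G a‖ + D / 2 * (t / 8) := by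
      rw [hD, ← h6, ← norm_mul, h7]
      refine (norm_sub_le _ _).trans ?_
      rw [h6]
      linarith
    linarith
  have hfreq : ∃ᶠ w in 𝓝 a, G w ≠ G a := by
    intro hev
    simp only [not_not] at hev
    have : deriv G a = 0 := by
      rw [(show G =ᶠ[𝓝 a] fun _ => G a from hev).deriv_eq, deriv_const]
    rw [hD, this, norm_zero] at hDpos
    exact lt_irrefl _ hDpos
  have himg := DiffContOnCl.ball_subset_image_closedBall (z₀ := a) (r := t / 8)
    (((hG.mono hbt).mono hcb).diffContOnCl_ball (subset_refl _)) (by linarith) hlin hfreq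
  refine hR (G a) ((ball_subset_ball ?_).trans (himg.trans (image_mono (hcb.trans hbt))))
  nlinarith

lemma exists_cosh_eq_natCast (x : ℝ) : ∃ y : ℝ, |y - x| ≤ 2 ∧ ∃ k : ℕ, Real.cosh y = k := by
  have key : ∀ x : ℝ, 0 ≤ x → ∃ y : ℝ, |y - x| ≤ 2 ∧ ∃ k : ℕ, Real.cosh y = k := fun x hx => by
    have h2 : 2 ≤ Real.cosh 2 := by
      have h1 : (1 : ℝ) ≤ Real.sinh 1 := Real.self_le_sinh_iff.2 zero_le_one
      have h3 := Real.cosh_two_mul 1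
      have h4 := Real.cosh_sq 1
      norm_num at h3
      nlinarith
    have h3 : Real.cosh x + 1 ≤ Real.cosh (x + 2) := by
      rw [Real.cosh_add]
      have h4 := Real.one_le_cosh x
      have h5 : 0 ≤ Real.sinh x * Real.sinh 2 :=
        mul_nonneg (Real.sinh_nonneg_iff.2 hx) (Real.sinh_nonneg_iff.2 zero_le_two)
      nlinarith
    obtain ⟨y, hy, hyk⟩ := intermediate_value_Icc (show x ≤ x + 2 by linarith)
      Real.continuous_cosh.continuousOn
      (show (⌈Real.cosh x⌉₊ : ℝ) ∈ Icc (Real.cosh x) (Real.cosh (x + 2)) from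
        ⟨Nat.le_ceil _, (Nat.ceil_lt_add_one (Real.cosh_pos x).le).le.trans h3⟩)
    exact ⟨y, abs_le.2 ⟨by linarith [hy.1], by linarith [hy.2]⟩, _, hyk⟩
  rcases le_total 0 x with h | h
  · exact key x h
  · obtain ⟨y, hy, k, hk⟩ := key (-x) (by linarith)
    refine ⟨-y, ?_, k, by rw [Real.cosh_neg, hk]⟩
    rw [← abs_neg]
    convert hy using 2
    ring

lemma exists_cos_eq_intCast (c : ℂ) : ∃ p ∈ ball c 4, ∃ k : ℤ, cos p = k := by
  obtain ⟨y, hy, k, hk⟩ := exists_cosh_eq_natCast c.im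
  refine ⟨(round (c.re / Real.pi) : ℂ) * Real.pi + y * I, ?_, ?_⟩
  · rw [mem_ball, dist_eq_norm]
    refine (norm_le_abs_re_add_abs_im _).trans_lt ?_
    have h1 := abs_sub_round (c.re / Real.pi)
    have h2 : |(round (c.re / Real.pi) : ℝ) * Real.pi - c.re| ≤ 1 / 2 * Real.pi := by
      rw [show (round (c.re / Real.pi) : ℝ) * Real.pi - c.re
        = -((c.re / Real.pi - round (c.re / Real.pi)) * Real.pi) by field_simp; ring, abs_neg,
        abs_mul, abs_of_pos Real.pi_pos]
      gcongr
    have h3 := Real.pi_lt_four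
    simp only [sub_re, add_re, mul_re, intCast_re, ofReal_re, intCast_im, ofReal_im, I_re, I_im,
      sub_im, add_im, mul_im]
    simp only [mul_zero, zero_mul, sub_zero, add_zero, mul_one, zero_add]
    linarith
  · have hs : sin (round (c.re / Real.pi) * Real.pi) = 0 := sin_int_mul_pi _
    have hc : cos (round (c.re / Real.pi) * Real.pi) ^ 2 = 1 := by
      have := sin_sq_add_cos_sq (round (c.re / Real.pi) * Real.pi : ℂ)
      rwa [hs, zero_pow two_ne_zero, zero_add] at this
    have hy' : cosh (y : ℂ) = k := by rw [← ofReal_cosh, hk, ofReal_natCast]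
    rw [cos_add, hs, zero_mul, sub_zero, cos_mul_I, hy']
    rcases sq_eq_sq_iff_eq_or_eq_neg.1 (hc.trans (one_pow 2).symm) with h | h
    · exact ⟨k, by rw [h]; simp⟩
    · exact ⟨-k, by rw [h]; simp⟩

/-- The Schottky theorem. -/
lemma schottky {w₀ : ℂ} {r : ℝ} (hr : r < 1) : ∃ B : ℝ, ∀ h : ℂ → ℂ,
    DifferentiableOn ℂ h (ball 0 1) → (∀ z ∈ ball (0 : ℂ) 1, h z ≠ 0) →
    (∀ z ∈ ball (0 : ℂ) 1, h z ≠ 1) → h 0 = w₀ → ∀ z ∈ closedBall (0 : ℂ) r, ‖h z‖ ≤ B := by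
  obtain ⟨w₁, hw₁⟩ := cos_surjective (2 * w₀ - 1)
  obtain ⟨w₂, hw₂⟩ := cos_surjective (w₁ / Real.pi)
  set K := ‖w₂‖ + 64 * 4 / ((1 - r) / 2) * 1 with hK
  have hcos : ∀ x : ℂ, ∀ b, ‖x‖ ≤ b → ‖cos x‖ ≤ Real.exp b := fun x b hx => by
    have h1 := norm_exp_le_of_norm_le (w := x * I) (x := b) (by simpa using hx)
    have h2 := norm_exp_le_of_norm_le (w := -x * I) (x := b) (by simpa using hx)
    rw [cos, norm_div, norm_ofNat]
    have := norm_add_le (exp (x * I)) (exp (-x * I))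
    linarith
  refine ⟨1 + Real.exp (Real.pi * Real.exp K), fun h hd h0 h1 hw z hz => ?_⟩
  have hb0 : (0 : ℂ) ∈ ball (0 : ℂ) 1 := mem_ball_self one_pos
  obtain ⟨F, hF, hF0, hFh⟩ := exists_cos_lift one_pos (f := fun z => 2 * h z - 1)
    ((hd.const_mul 2).sub_const 1)
    (fun z hz e => h1 z hz (by linear_combination e / 2))
    (fun z hz e => h0 z hz (by linear_combination e / 2)) (w₀ := w₁) (by rw [hw₁, hw])
  have hpi : (Real.pi : ℂ) ≠ 0 := ofReal_ne_zero.2 Real.pi_ne_zero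
  have hFint : ∀ z ∈ ball (0 : ℂ) 1, ∀ k : ℤ, F z / Real.pi ≠ k := fun z hz k e => by
    rw [div_eq_iff hpi] at e
    have h2 := hFh z hz
    have h3 : sin (F z) = 0 := by rw [e, sin_int_mul_pi]
    have h4 := sin_sq_add_cos_sq (F z)
    rw [h3, ← h2] at h4
    have h5 : h z * (h z - 1) = 0 := by linear_combination h4 / 4
    rcases mul_eq_zero.1 h5 with h5 | h5
    · exact h0 z hz h5
    · exact h1 z hz (sub_eq_zero.1 h5)
  obtain ⟨G, hG, hG0, hGF⟩ := exists_cos_lift one_pos (f := fun z => F z / Real.pi)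
    (hF.div_const _)
    (fun z hz e => hFint z hz 1 (by simpa using e))
    (fun z hz e => hFint z hz (-1) (by simpa using e)) (w₀ := w₂) (by rw [hw₂, hF0])
  have hno : ∀ c, ¬ ball c 4 ⊆ G '' ball 0 1 := fun c hc => by
    obtain ⟨p, hp, k, hk⟩ := exists_cos_eq_intCast c
    obtain ⟨z, hz, rfl⟩ := hc hp
    exact hFint z hz k (by rw [hGF z hz, hk])
  have hr0 : 0 ≤ r := nonempty_closedBall.1 ⟨z, hz⟩
  have hr1 : closedBall (0 : ℂ) r ⊆ ball 0 1 := closedBall_subset_ball hr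
  have hz1 := hr1 hz
  have hGz : ‖G z‖ ≤ K := by
    have h2 := (convex_closedBall (0 : ℂ) r).norm_image_sub_le_of_norm_deriv_le
      (f := G) (C := 64 * 4 / ((1 - r) / 2)) (x := 0) (y := z)
      (fun x hx => hG.differentiableAt (isOpen_ball.mem_nhds (hr1 hx)))
      (fun x hx => by
        rw [mem_closedBall, dist_zero_right] at hx
        have h3 := norm_deriv_mul_le_of_not_ball_subset (ρ := (1 + r) / 2) (by linarith) hG hno
          (z := x) (by rw [mem_closedBall, dist_zero_right]; linarith)
        rw [le_div_iff₀ (by linarith)]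
        refine (mul_le_mul_of_nonneg_left ?_ (norm_nonneg _)).trans h3
        linarith)
      (mem_closedBall_self hr0) hz
    rw [hG0, sub_zero] at h2
    have h3 := norm_le_norm_add_norm_sub' (G z) w₂
    have h4 : ‖z‖ ≤ 1 := by
      rw [mem_closedBall, dist_zero_right] at hz; linarith
    have h5 : 0 ≤ 64 * 4 / ((1 - r) / 2) := by
      have : 0 < 1 - r := by linarith
      positivity
    have h6 := mul_le_mul_of_nonneg_left h4 h5
    linarith
  have hFz : ‖F z‖ ≤ Real.pi * Real.exp K := by
    have h2 := hcos _ _ hGz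
    rw [← hGF z hz1, norm_div, norm_real, Real.norm_of_nonneg Real.pi_pos.le,
      div_le_iff₀ Real.pi_pos] at h2
    linarith
  have h2 := hcos _ _ hFz
  rw [← hFh z hz1] at h2
  have h3 : h z = ((2 * h z - 1) + 1) / 2 := by ring
  rw [h3, norm_div, norm_ofNat]
  have h4 := norm_add_le (2 * h z - 1) 1
  rw [norm_one] at h4
  have h5 := Real.exp_pos (Real.pi * Real.exp K)
  linarith

end Schottky

section Limits
open Filter Topology

lemma differentiableOn_ball_of_tendsto {κ : Type*} {p : Filter κ} [p.NeBot] {h : κ → ℂ → ℂ}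
    {φ : ℂ → ℂ} (hlim : TendstoLocallyUniformlyOn h φ p (ball 0 1))
    (hd : ∀ r < 1, ∀ᶠ k in p, DifferentiableOn ℂ (h k) (ball 0 r)) :
    DifferentiableOn ℂ φ (ball 0 1) := fun z hz => by
  rw [mem_ball, dist_zero_right] at hz
  obtain ⟨r, hzr, hr⟩ := exists_between hz
  have h1 := (hlim.mono (ball_subset_ball hr.le)).differentiableOn (hd r hr) isOpen_ball
  exact (h1.differentiableAt (isOpen_ball.mem_nhds
    (by rwa [mem_ball, dist_zero_right]))).differentiableWithinAt

/-- The Montel theorem along an ultrafilter. -/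
lemma exists_tendstoLocallyUniformlyOn_ball {κ : Type*} (p : Ultrafilter κ) {h : κ → ℂ → ℂ}
    (hd : ∀ r < 1, ∀ᶠ k in (p : Filter κ), DifferentiableOn ℂ (h k) (ball 0 r))
    (hb : ∀ r < 1, ∃ B : ℝ, ∀ᶠ k in (p : Filter κ), ∀ z ∈ closedBall (0 : ℂ) r, ‖h k z‖ ≤ B) :
    ∃ φ : ℂ → ℂ, TendstoLocallyUniformlyOn h φ p (ball 0 1) := by
  have hpt : ∀ z : ℂ, ∃ y, z ∈ ball (0 : ℂ) 1 → Tendsto (fun k => h k z) p (𝓝 y) := fun z => by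
    by_cases hz : z ∈ ball (0 : ℂ) 1
    · rw [mem_ball, dist_zero_right] at hz
      obtain ⟨B, hB⟩ := hb _ hz
      obtain ⟨y, -, hy⟩ := (isCompact_closedBall (0 : ℂ) B).ultrafilter_le_nhds
        (p.map fun k => h k z) (by
          rw [le_principal_iff]
          change ∀ᶠ k in (p : Filter κ), h k z ∈ closedBall (0 : ℂ) B
          filter_upwards [hB] with k hk
          rw [mem_closedBall, dist_zero_right]
          exact hk z (by simp))
      exact ⟨y, fun _ => hy⟩
    · exact ⟨0, fun h => absurd h hz⟩
  choose φ hφ using hpt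
  refine ⟨φ, Metric.tendstoLocallyUniformlyOn_iff.2 fun ε hε x hx => ?_⟩
  have hx' : ‖x‖ < 1 := by simpa using hx
  obtain ⟨r, hr1, hr2⟩ := exists_between hx'
  obtain ⟨B, hB⟩ := hb r hr2
  have hδ : 0 < r - ‖x‖ := by linarith
  have hsub : ball x (r - ‖x‖) ⊆ ball 0 r := ball_subset_ball' (by simp)
  have hlip : ∀ᶠ k in (p : Filter κ), ∀ y ∈ ball x (r - ‖x‖),
      ‖h k y - h k x‖ ≤ (2 * |B| / (r - ‖x‖)) * ‖y - x‖ := by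
    filter_upwards [hB, hd r hr2] with k hk hdk y hy
    have := Complex.dist_le_div_mul_dist_of_mapsTo_ball (R₂ := 2 * |B|) (hdk.mono hsub)
      (fun w hw => ?_) hy
    · simpa [dist_eq_norm] using this
    · rw [mem_closedBall, dist_eq_norm]
      refine (norm_sub_le _ _).trans ?_
      have h1 := hk w (ball_subset_closedBall (hsub hw))
      have h2 := hk x (ball_subset_closedBall (hsub (mem_ball_self hδ)))
      have h3 := le_abs_self B
      linarith
  set L := 2 * |B| / (r - ‖x‖) with hL
  have hL0 : 0 ≤ L := by positivity
  have hlipφ : ∀ y ∈ ball x (r - ‖x‖), ‖φ y - φ x‖ ≤ L * ‖y - x‖ := fun y hy => by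
    refine le_of_tendsto ((((hφ y ?_).sub (hφ x hx))).norm) ?_
    · exact ball_subset_ball hr2.le (hsub hy)
    · filter_upwards [hlip] with k hk using hk y hy
  obtain ⟨δ, hδ0, hδr, hδε⟩ : ∃ δ > 0, δ ≤ r - ‖x‖ ∧ L * δ ≤ ε / 3 := by
    refine ⟨min (r - ‖x‖) (ε / 3 / (L + 1)), lt_min hδ (by positivity), min_le_left _ _, ?_⟩
    calc L * min (r - ‖x‖) (ε / 3 / (L + 1)) ≤ (L + 1) * (ε / 3 / (L + 1)) := by
          gcongr
          · linarith
          · exact min_le_right _ _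
      _ = ε / 3 := by field_simp
  refine ⟨ball x δ, mem_nhdsWithin_of_mem_nhds (ball_mem_nhds x hδ0), ?_⟩
  filter_upwards [hlip, Metric.tendsto_nhds.1 (hφ x hx) (ε / 3) (by positivity)] with k hk hkx y hy
  have hy' := ball_subset_ball hδr hy
  have h1 := hk y hy'
  have h2 := hlipφ y hy'
  rw [dist_eq_norm] at hkx
  have h3 : ‖y - x‖ ≤ δ := by
    rw [mem_ball, dist_eq_norm] at hy
    exact hy.le
  have h4 : L * ‖y - x‖ ≤ ε / 3 := (mul_le_mul_of_nonneg_left h3 hL0).trans hδε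
  rw [dist_eq_norm]
  have h5 : φ y - h k y = (φ y - φ x) - (h k x - φ x) - (h k y - h k x) := by ring
  rw [h5]
  have h6 := norm_sub_le ((φ y - φ x) - (h k x - φ x)) (h k y - h k x)
  have h7 := norm_sub_le (φ y - φ x) (h k x - φ x)
  linarith

/-- The Hurwitz theorem on limits of zero-free holomorphic functions. -/
lemma ne_zero_of_tendstoLocallyUniformlyOn_ball {κ : Type*} {p : Filter κ} [p.NeBot]
    {h : κ → ℂ → ℂ} {φ : ℂ → ℂ} (hlim : TendstoLocallyUniformlyOn h φ p (ball 0 1))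
    (hd : ∀ r < 1, ∀ᶠ k in p, DifferentiableOn ℂ (h k) (ball 0 r))
    (h0 : ∀ r < 1, ∀ᶠ k in p, ∀ z ∈ ball (0 : ℂ) r, h k z ≠ 0)
    (hφ0 : φ 0 ≠ 0) {z : ℂ} (hz : z ∈ ball (0 : ℂ) 1) : φ z ≠ 0 := by
  intro hφz
  have hφ := differentiableOn_ball_of_tendsto hlim hd
  have han : AnalyticOnNhd ℂ φ (ball 0 1) := hφ.analyticOnNhd isOpen_ball
  have hz' : ‖z‖ < 1 := by simpa using hz
  obtain ⟨r, hr1, hr2⟩ := exists_between hz'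
  rcases (han z hz).eventually_eq_zero_or_eventually_ne_zero with hev | hev
  · exact hφ0 (han.eqOn_zero_of_preconnected_of_eventuallyEq_zero
      (convex_ball (0 : ℂ) 1).isPreconnected hz hev (mem_ball_self one_pos))
  rw [eventually_nhdsWithin_iff, Metric.eventually_nhds_iff] at hev
  obtain ⟨ε, hε, hev⟩ := hev
  obtain ⟨δ, hδ0, hδ⟩ := exists_between (show 0 < min ε (r - ‖z‖) from lt_min hε (by linarith))
  have hsub : closedBall z δ ⊆ ball 0 r := closedBall_subset_ball' (by
    rw [dist_zero_right]; linarith [hδ.trans_le (min_le_right _ _)])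
  have hsub1 : closedBall z δ ⊆ ball 0 1 := hsub.trans (ball_subset_ball hr2.le)
  have hsph : sphere z δ ⊆ closedBall z δ := sphere_subset_closedBall
  obtain ⟨w, hw, hmin⟩ := (isCompact_sphere z δ).exists_isMinOn
    (NormedSpace.sphere_nonempty.2 hδ0.le) ((hφ.continuousOn.mono (hsph.trans hsub1)).norm)
  have hm : 0 < ‖φ w‖ := by
    rw [norm_pos_iff]
    have hwd : dist w z = δ := hw
    exact hev (by rw [hwd]; exact hδ.trans_le (min_le_left _ _))
      (fun e => by rw [mem_singleton_iff] at e; rw [e, dist_self] at hwd; linarith)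
  have hunif := (tendstoLocallyUniformlyOn_iff_forall_isCompact isOpen_ball).1 hlim
    _ hsub1 (isCompact_closedBall z δ)
  obtain ⟨k, hk, hkd, hk0⟩ := ((Metric.tendstoUniformlyOn_iff.1 hunif (‖φ w‖ / 2)
    (by positivity)).and ((hd r hr2).and (h0 r hr2))).exists
  have hinv : DifferentiableOn ℂ (fun z => (h k z)⁻¹) (closedBall z δ) :=
    (hkd.inv hk0).mono hsub
  have hmax := Complex.norm_le_of_forall_mem_frontier_norm_le (U := ball z δ) isBounded_ball
    (hinv.diffContOnCl_ball (subset_refl _)) (C := (‖φ w‖ / 2)⁻¹) (fun x hx => by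
      rw [frontier_ball _ hδ0.ne'] at hx
      rw [norm_inv]
      refine inv_anti₀ (by positivity) ?_
      have h1 := hk x (hsph hx)
      rw [dist_eq_norm] at h1
      have h2 := hmin hx
      simp only [mem_ofPred_eq] at h2
      have h3 := norm_le_norm_add_norm_sub (h k x) (φ x)
      rw [norm_sub_rev] at h3
      have h4 := norm_sub_rev (h k x) (φ x)
      linarith) (subset_closure (mem_ball_self hδ0))
  have hzc := mem_closedBall_self (x := z) hδ0.le
  have h1 := hk z hzc
  rw [hφz, dist_zero_left] at h1
  have h2 : 0 < ‖h k z‖ := norm_pos_iff.2 (hk0 z (hsub hzc))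
  rw [norm_inv] at hmax
  have h3 := (inv_le_inv₀ h2 (by positivity)).1 hmax
  linarith

lemma exists_avoiding_on_ball {ι : Type*} [Finite ι] {f : ι → ℂ → ℂ}
    (hf : ∀ i, DifferentiableOn ℂ (f i) (ball 0 1))
    (hne : ∀ i j, i ≠ j → ∀ z ∈ ball (0 : ℂ) 1, f i z ≠ f j z) {z₀ : ℂ} (hz₀ : ∀ i, z₀ ≠ f i 0)
    {r : ℝ} (hr0 : 0 < r) (hr : r < 1) :
    ∃ g : ℂ → ℂ, DifferentiableOn ℂ g (ball 0 r) ∧ g 0 = z₀ ∧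
      ∀ z ∈ ball (0 : ℂ) r, ∀ i, g z ≠ f i z := by
  have hrC : (r : ℂ) ≠ 0 := ofReal_ne_zero.2 hr0.ne'
  have hmul : ∀ z ∈ ball (0 : ℂ) r⁻¹, (r : ℂ) * z ∈ ball (0 : ℂ) 1 := fun z hz => by
    rw [mem_ball, dist_zero_right] at hz ⊢
    rw [norm_mul, norm_real, Real.norm_of_nonneg hr0.le]
    calc r * ‖z‖ < r * r⁻¹ := by gcongr
      _ = 1 := mul_inv_cancel₀ hr0.ne'
  obtain ⟨g, hg, hg0, hgf⟩ := exists_avoiding_of_one_lt (f := fun i z => f i (r * z))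
    (ρ := r⁻¹) ((one_lt_inv₀ hr0).2 hr)
    (fun i => (hf i).comp (differentiableOn_id.const_mul _) hmul)
    (fun i j hij z hz => hne i j hij _ (hmul z hz)) (z₀ := z₀) (fun i => by simpa using hz₀ i)
  have hdiv : ∀ z ∈ ball (0 : ℂ) r, (r : ℂ)⁻¹ * z ∈ ball (0 : ℂ) 1 := fun z hz => by
    rw [mem_ball, dist_zero_right] at hz ⊢
    rw [norm_mul, norm_inv, norm_real, Real.norm_of_nonneg hr0.le]
    calc r⁻¹ * ‖z‖ < r⁻¹ * r := by gcongr
      _ = 1 := inv_mul_cancel₀ hr0.ne'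
  refine ⟨fun z => g ((r : ℂ)⁻¹ * z), hg.comp (differentiableOn_id.const_mul _) hdiv,
    by simpa using hg0, fun z hz i => ?_⟩
  have := hgf _ (hdiv z hz) i
  rwa [mul_inv_cancel_left₀ hrC] at this

lemma schottky_ball {w₀ : ℂ} {r R : ℝ} (hr0 : 0 ≤ r) (hr : r < R) : ∃ B : ℝ, ∀ h : ℂ → ℂ,
    DifferentiableOn ℂ h (ball 0 R) → (∀ z ∈ ball (0 : ℂ) R, h z ≠ 0) →
    (∀ z ∈ ball (0 : ℂ) R, h z ≠ 1) → h 0 = w₀ → ∀ z ∈ closedBall (0 : ℂ) r, ‖h z‖ ≤ B := by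
  have hR : 0 < R := hr0.trans_lt hr
  have hRC : (R : ℂ) ≠ 0 := ofReal_ne_zero.2 hR.ne'
  obtain ⟨B, hB⟩ := schottky (w₀ := w₀) (r := r / R) ((div_lt_one hR).2 hr)
  refine ⟨B, fun h hd h0 h1 hw z hz => ?_⟩
  have hmul : ∀ z ∈ ball (0 : ℂ) 1, (R : ℂ) * z ∈ ball (0 : ℂ) R := fun z hz => by
    rw [mem_ball, dist_zero_right] at hz ⊢
    rw [norm_mul, norm_real, Real.norm_of_nonneg hR.le]
    nlinarith
  have := hB (fun z => h (R * z)) (hd.comp (differentiableOn_id.const_mul _) hmul)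
    (fun z hz => h0 _ (hmul z hz)) (fun z hz => h1 _ (hmul z hz)) (by simpa using hw)
    (z / R) (by
      rw [mem_closedBall, dist_zero_right] at hz ⊢
      rw [norm_div, norm_real, Real.norm_of_nonneg hR.le]
      gcongr)
  simpa only [mul_div_cancel₀ _ hRC] using this

lemma exists_avoiding {ι : Type*} [Finite ι] {f : ι → ℂ → ℂ}
    (hf : ∀ i, DifferentiableOn ℂ (f i) (ball 0 1))
    (hne : ∀ i j, i ≠ j → ∀ z ∈ ball (0 : ℂ) 1, f i z ≠ f j z)
    {z₀ : ℂ} (hz₀ : ∀ i, z₀ ≠ f i 0) :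
    ∃ g : ℂ → ℂ, DifferentiableOn ℂ g (ball 0 1) ∧ g 0 = z₀ ∧
      ∀ z ∈ ball (0 : ℂ) 1, ∀ i, g z ≠ f i z := by
  have hb0 : (0 : ℂ) ∈ ball (0 : ℂ) 1 := mem_ball_self one_pos
  rcases subsingleton_or_nontrivial ι with hι | hι
  · rcases isEmpty_or_nonempty ι with he | ⟨⟨i⟩⟩
    · exact ⟨fun _ => z₀, differentiableOn_const _, rfl, fun _ _ i => he.elim i⟩
    · refine ⟨fun z => f i z + (z₀ - f i 0), (hf i).add_const _, by ring, fun z _ j => ?_⟩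
      rw [Subsingleton.elim j i]
      simpa [sub_eq_zero] using hz₀ i
  obtain ⟨i, j, hij⟩ := exists_pair_ne ι
  have hD : ∀ z ∈ ball (0 : ℂ) 1, f j z - f i z ≠ 0 := fun z hz =>
    sub_ne_zero.2 (hne j i hij.symm z hz)
  obtain ⟨R, hR0, hR1, hRlim⟩ : ∃ R : ℕ → ℝ, (∀ k, 0 < R k) ∧ (∀ k, R k < 1) ∧
      Tendsto R atTop (𝓝 1) := by
    obtain ⟨R, -, hR, hlim⟩ := exists_seq_strictMono_tendsto' (x := (1 : ℝ)) one_pos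
    exact ⟨R, fun k => (hR k).1, fun k => (hR k).2, hlim⟩
  have hRev : ∀ r < 1, ∀ᶠ k in (hyperfilter ℕ : Filter ℕ), r < R k := fun r hr => by
    have h1 : ∀ᶠ k in atTop, r < R k := hRlim.eventually (lt_mem_nhds hr)
    rw [← Nat.cofinite_eq_atTop] at h1
    exact Filter.hyperfilter_le_cofinite h1
  choose g hg hg0 hgf using fun k => exists_avoiding_on_ball hf hne hz₀ (hR0 k) (hR1 k)
  set h : ℕ → ℂ → ℂ := fun k z => (g k z - f i z) / (f j z - f i z) with hh
  have hd' : ∀ k, DifferentiableOn ℂ (h k) (ball 0 (R k)) := fun k =>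
    have hs := ball_subset_ball (x := (0 : ℂ)) (hR1 k).le
    ((hg k).sub ((hf i).mono hs)).div (((hf j).mono hs).sub ((hf i).mono hs))
      fun z hz => hD z (hs hz)
  have hd : ∀ r < 1, ∀ᶠ k in (hyperfilter ℕ : Filter ℕ), DifferentiableOn ℂ (h k) (ball 0 r) :=
    fun r hr => by
      filter_upwards [hRev r hr] with k hk using (hd' k).mono (ball_subset_ball hk.le)
  have hav : ∀ m k, ∀ z ∈ ball (0 : ℂ) (R k), h k z - (f m z - f i z) / (f j z - f i z) ≠ 0 :=
    fun m k z hz e => by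
      have hDz := hD z (ball_subset_ball (hR1 k).le hz)
      rw [hh] at e
      simp only [← sub_div] at e
      rw [div_eq_zero_iff, or_iff_left hDz] at e
      exact hgf k z hz m (by linear_combination e)
  have hh0 : ∀ k, h k 0 = (z₀ - f i 0) / (f j 0 - f i 0) := fun k => by simp only [hh, hg0]
  have hb : ∀ r < 1, ∃ B : ℝ, ∀ᶠ k in (hyperfilter ℕ : Filter ℕ),
      ∀ z ∈ closedBall (0 : ℂ) r, ‖h k z‖ ≤ B := fun r hr => by
    rcases lt_or_ge r 0 with hr0 | hr0
    · refine ⟨0, Eventually.of_forall fun k z hz => ?_⟩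
      rw [closedBall_eq_empty.2 hr0] at hz
      exact hz.elim
    obtain ⟨s, hrs, hs⟩ := exists_between hr
    obtain ⟨B, hB⟩ := schottky_ball (w₀ := (z₀ - f i 0) / (f j 0 - f i 0)) hr0 hrs
    refine ⟨B, ?_⟩
    filter_upwards [hRev s hs] with k hk
    have hsk : ball (0 : ℂ) s ⊆ ball 0 (R k) := ball_subset_ball hk.le
    refine hB (h k) ((hd' k).mono hsk) (fun z hz => ?_) (fun z hz => ?_) (hh0 k)
    · simpa using hav i k z (hsk hz)
    · have h1 := hav j k z (hsk hz)
      rwa [div_self (hD z (ball_subset_ball hs.le hz)), sub_ne_zero] at h1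
  obtain ⟨φ, hφ⟩ := exists_tendstoLocallyUniformlyOn_ball (hyperfilter ℕ) hd hb
  have hφ0 : φ 0 = (z₀ - f i 0) / (f j 0 - f i 0) := by
    refine tendsto_nhds_unique (hφ.tendsto_at hb0) ?_
    simp only [hh0]
    exact tendsto_const_nhds
  have hφd := differentiableOn_ball_of_tendsto hφ hd
  refine ⟨fun z => φ z * (f j z - f i z) + f i z, (hφd.mul ((hf j).sub (hf i))).add (hf i), ?_,
    fun z hz m e => ?_⟩
  · simp only [hφ0]
    rw [div_mul_cancel₀ _ (hD 0 hb0), sub_add_cancel]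
  have hψ : DifferentiableOn ℂ (fun z => (f m z - f i z) / (f j z - f i z)) (ball 0 1) :=
    ((hf m).sub (hf i)).div ((hf j).sub (hf i)) hD
  have hlim : TendstoLocallyUniformlyOn (fun k z => h k z - (f m z - f i z) / (f j z - f i z))
      (fun z => φ z - (f m z - f i z) / (f j z - f i z)) (hyperfilter ℕ) (ball 0 1) := by
    rw [Metric.tendstoLocallyUniformlyOn_iff] at hφ ⊢
    simpa only [dist_sub_right] using hφ
  refine ne_zero_of_tendstoLocallyUniformlyOn_ball hlim ?_ ?_ ?_ hz ?_
  · intro r hr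
    filter_upwards [hd r hr] with k hk using hk.sub (hψ.mono (ball_subset_ball hr.le))
  · intro r hr
    filter_upwards [hRev r hr] with k hk z hz using hav m k z (ball_subset_ball hk.le hz)
  · rw [hφ0, ← sub_div]
    exact div_ne_zero (by rw [sub_sub_sub_cancel_right]; exact sub_ne_zero.2 (hz₀ m)) (hD 0 hb0)
  · rw [sub_eq_zero, eq_div_iff (hD z hz)]
    linear_combination e

end Limits

section Frames
open Filter Topology

/-- The point of the Riemann sphere with homogeneous coordinates `[p : q]`. -/
def projMk (p q : ℂ) : OnePoint ℂ :=
  if q = 0 then OnePoint.infty else ((p / q : ℂ) : OnePoint ℂ)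

/-- The affine coordinate on the Riemann sphere, with value `0` at infinity. -/
def affineCoord (x : OnePoint ℂ) : ℂ := Option.elim x 0 id

lemma affineCoord_projMk (p q : ℂ) : affineCoord (projMk p q) = p / q := by
  rw [projMk]
  split_ifs with h
  · rw [h, div_zero]; rfl
  · rfl

lemma projMk_one (z : ℂ) : projMk z 1 = z := by
  rw [projMk, if_neg one_ne_zero, div_one]

lemma projMk_zero_right (p : ℂ) : projMk p 0 = OnePoint.infty := if_pos rfl

lemma projMk_eq_iff {p q p' q' : ℂ} (h : p ≠ 0 ∨ q ≠ 0) (h' : p' ≠ 0 ∨ q' ≠ 0) :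
    projMk p q = projMk p' q' ↔ p * q' = p' * q := by
  rw [projMk, projMk]
  split_ifs with h1 h2 h2
  · simp [h1, h2]
  · subst h1
    simp only [OnePoint.infty_ne_coe, mul_zero, mul_eq_zero, h2, or_false, false_iff]
    simpa using h
  · subst h2
    simp only [OnePoint.coe_ne_infty, mul_zero, false_iff]
    simpa [eq_comm, h1] using h'
  · rw [OnePoint.coe_eq_coe, div_eq_div_iff h1 h2]

lemma exists_projMk_eq (x : OnePoint ℂ) : ∃ p q : ℂ, (p ≠ 0 ∨ q ≠ 0) ∧ x = projMk p q := by
  induction x using OnePoint.rec with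
  | infty => exact ⟨1, 0, Or.inl one_ne_zero, (projMk_zero_right 1).symm⟩
  | coe z => exact ⟨z, 1, Or.inr one_ne_zero, (projMk_one z).symm⟩

lemma sphereInv_projMk {p q : ℂ} (h : p ≠ 0 ∨ q ≠ 0) :
    sphereInv (projMk p q) = projMk q p := by
  rw [projMk, projMk]
  split_ifs with h1 h2 h2
  · simp [h1, h2] at h
  · rw [h1, zero_div]; rfl
  · subst h2
    exact (if_pos (zero_div q))
  · exact (if_neg (div_ne_zero h2 h1)).trans (by rw [inv_div])

lemma sphereInv_sphereInv (x : OnePoint ℂ) : sphereInv (sphereInv x) = x := by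
  obtain ⟨p, q, h, rfl⟩ := exists_projMk_eq x
  rw [sphereInv_projMk h, sphereInv_projMk h.symm]

lemma HolomorphicOnSphere.exists_projMk {u : ℂ → OnePoint ℂ} {s : Set ℂ}
    (hu : HolomorphicOnSphere u s) {z : ℂ} (hz : z ∈ s) :
    ∃ p q : ℂ → ℂ, AnalyticAt ℂ p z ∧ AnalyticAt ℂ q z ∧
      ∀ᶠ w in 𝓝 z, (p w ≠ 0 ∨ q w ≠ 0) ∧ u w = projMk (p w) (q w) := by
  obtain ⟨v, hv, h | h⟩ := hu z hz
  · refine ⟨v, fun _ => 1, hv, analyticAt_const, ?_⟩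
    filter_upwards [h] with w hw using ⟨Or.inr one_ne_zero, by rw [hw, projMk_one]⟩
  · refine ⟨fun _ => 1, v, analyticAt_const, hv, ?_⟩
    filter_upwards [h] with w hw
    refine ⟨Or.inl one_ne_zero, ?_⟩
    rw [← sphereInv_sphereInv (u w), hw, ← projMk_one, sphereInv_projMk (Or.inr one_ne_zero)]

lemma holomorphicOnSphere_of_projMk {u : ℂ → OnePoint ℂ} {s : Set ℂ}
    (h : ∀ z ∈ s, ∃ p q : ℂ → ℂ, AnalyticAt ℂ p z ∧ AnalyticAt ℂ q z ∧ (p z ≠ 0 ∨ q z ≠ 0) ∧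
      ∀ᶠ w in 𝓝 z, u w = projMk (p w) (q w)) : HolomorphicOnSphere u s := fun z hz => by
  obtain ⟨p, q, hp, hq, h0, hu⟩ := h z hz
  rcases h0 with h0 | h0
  · refine ⟨fun w => q w / p w, hq.div hp h0, Or.inr ?_⟩
    filter_upwards [hu, hp.continuousAt.eventually_ne h0] with w hw hw0
    rw [hw, sphereInv_projMk (Or.inl hw0), projMk, if_neg hw0]
  · refine ⟨fun w => p w / q w, hp.div hq h0, Or.inl ?_⟩
    filter_upwards [hu, hq.continuousAt.eventually_ne h0] with w hw hw0
    rw [hw, projMk, if_neg hw0]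

/-- A holomorphic family of unimodular matrices on `s` sending infinity to `u`. -/
structure IsFrame (u : ℂ → OnePoint ℂ) (M : ℂ → Fin 2 → Fin 2 → ℂ) (s : Set ℂ) : Prop where
  differentiableOn : ∀ i j, DifferentiableOn ℂ (fun z => M z i j) s
  det_eq_one : ∀ z ∈ s, M z 0 0 * M z 1 1 - M z 0 1 * M z 1 0 = 1
  lift_eq : ∀ z ∈ s, u z = projMk (M z 0 0) (M z 1 0)

lemma IsFrame.mono {u : ℂ → OnePoint ℂ} {M : ℂ → Fin 2 → Fin 2 → ℂ} {s t : Set ℂ}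
    (h : IsFrame u M t) (hst : s ⊆ t) : IsFrame u M s :=
  ⟨fun i j => (h.differentiableOn i j).mono hst, fun z hz => h.det_eq_one z (hst hz),
    fun z hz => h.lift_eq z (hst hz)⟩

lemma IsFrame.ne_zero {u : ℂ → OnePoint ℂ} {M : ℂ → Fin 2 → Fin 2 → ℂ} {s : Set ℂ}
    (h : IsFrame u M s) {z : ℂ} (hz : z ∈ s) : M z 0 0 ≠ 0 ∨ M z 1 0 ≠ 0 := by
  by_contra! h0
  have := h.det_eq_one z hz
  simp [h0.1, h0.2] at this

/-- The quotient of two coprime polynomials determined by a divisor with finite support. -/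
lemma exists_coprime_polynomial_of_finite (D : ℂ → ℤ) (hD : D.support.Finite) :
    ∃ P Q : Polynomial ℂ, IsCoprime P Q ∧ Q ≠ 0 ∧
      ∀ z : ℂ, P.eval z / Q.eval z = (∏ᶠ u, (fun z : ℂ => z - u) ^ D u) z := by
  classical
  set S := hD.toFinset
  refine ⟨∏ u ∈ S, (Polynomial.X - Polynomial.C u) ^ (D u).toNat,
    ∏ u ∈ S, (Polynomial.X - Polynomial.C u) ^ (-D u).toNat, ?_, ?_, fun z => ?_⟩
  · refine IsCoprime.prod_left fun u _ => IsCoprime.prod_right fun w _ => ?_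
    by_cases huw : u = w
    · subst huw
      rcases le_total 0 (D u) with h | h
      · rw [Int.toNat_of_nonpos (show -D u ≤ 0 by omega), pow_zero]
        exact isCoprime_one_right
      · rw [Int.toNat_of_nonpos h, pow_zero]
        exact isCoprime_one_left
    · exact (Polynomial.isCoprime_X_sub_C_of_isUnit_sub (sub_ne_zero.2 huw).isUnit).pow
  · exact Finset.prod_ne_zero_iff.2 fun u _ => pow_ne_zero _ (Polynomial.X_sub_C_ne_zero u)
  · rw [finprod_eq_prod_of_mulSupport_subset (s := S), Finset.prod_apply, Polynomial.eval_prod,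
      Polynomial.eval_prod, ← Finset.prod_div_distrib]
    · refine Finset.prod_congr rfl fun u _ => ?_
      simp only [Polynomial.eval_pow, Polynomial.eval_sub, Polynomial.eval_X, Polynomial.eval_C,
        Pi.pow_apply]
      rcases le_total 0 (D u) with h | h
      · obtain ⟨n, hn⟩ := Int.eq_ofNat_of_zero_le h
        simp [hn]
      · obtain ⟨n, hn⟩ := Int.eq_ofNat_of_zero_le (show 0 ≤ -D u by omega)
        have hn' : D u = -n := by omega
        simp [hn']
    · intro u hu
      simp only [S, Finite.coe_toFinset, Function.mem_support]
      intro h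
      simp [h] at hu

end Frames

section LocalFrames
open Filter Topology

lemma eq_of_eventually_eq_nhdsNE {f g : ℂ → ℂ} {z : ℂ} (hf : ContinuousAt f z)
    (hg : ContinuousAt g z) (h : ∀ᶠ w in 𝓝[≠] z, f w = g w) : f z = g z :=
  tendsto_nhds_unique_of_eventuallyEq (hf.tendsto.mono_left nhdsWithin_le_nhds)
    (hg.tendsto.mono_left nhdsWithin_le_nhds) h

lemma eventually_eq_of_eventually_eq_nhdsNE {f g : ℂ → ℂ} {z : ℂ} (hf : ContinuousAt f z)
    (hg : ContinuousAt g z) (h : ∀ᶠ w in 𝓝[≠] z, f w = g w) : ∀ᶠ w in 𝓝 z, f w = g w := by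
  have h1 := eq_of_eventually_eq_nhdsNE hf hg h
  rw [eventually_nhdsWithin_iff] at h
  filter_upwards [h] with w hw
  by_cases e : w = z
  · rw [e, h1]
  · exact hw e

lemma HolomorphicOnSphere.meromorphicOn_affineCoord {u : ℂ → OnePoint ℂ} {s : Set ℂ}
    (hu : HolomorphicOnSphere u s) : MeromorphicOn (fun z => affineCoord (u z)) s := fun z hz => by
  obtain ⟨p, q, hp, hq, h⟩ := hu.exists_projMk hz
  refine (hp.meromorphicAt.div hq.meromorphicAt).congr (Filter.Eventually.filter_mono
    nhdsWithin_le_nhds ?_)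
  filter_upwards [h] with w hw
  rw [hw.2, affineCoord_projMk]
  rfl

lemma HolomorphicOnSphere.eq_infty_or_eq_zero {u : ℂ → OnePoint ℂ}
    (hu : HolomorphicOnSphere u (ball 0 1))
    (h : ∀ z ∈ ball (0 : ℂ) 1, ∀ᶠ w in 𝓝[≠] z, affineCoord (u w) = 0) :
    (∀ z ∈ ball (0 : ℂ) 1, u z = OnePoint.infty) ∨ (∀ z ∈ ball (0 : ℂ) 1, u z = (0 : ℂ)) := by
  classical
  have hloc : ∀ z ∈ ball (0 : ℂ) 1, (∀ᶠ w in 𝓝 z, u w = OnePoint.infty) ∨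
      (∀ᶠ w in 𝓝 z, u w = (0 : ℂ)) := fun z hz => by
    obtain ⟨p, q, hp, hq, hpq⟩ := hu.exists_projMk hz
    have h1 : ∀ᶠ w in 𝓝[≠] z, p w / q w = 0 := by
      filter_upwards [h z hz, hpq.filter_mono nhdsWithin_le_nhds] with w hw hw'
      rw [← hw, hw'.2, affineCoord_projMk]
    by_cases hqz : q z = 0
    · have hpz : p z ≠ 0 := hpq.self_of_nhds.1.resolve_right (not_not.2 hqz)
      have h2 : ∀ᶠ w in 𝓝 z, q w = 0 := by
        refine eventually_eq_of_eventually_eq_nhdsNE hq.continuousAt continuousAt_const ?_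
        filter_upwards [h1, (hp.continuousAt.eventually_ne hpz).filter_mono nhdsWithin_le_nhds]
          with w hw hw'
        exact (div_eq_zero_iff.1 hw).resolve_left hw'
      left
      filter_upwards [h2, hpq] with w hw hw'
      rw [hw'.2, hw, projMk_zero_right]
    · have hq0 := hq.continuousAt.eventually_ne hqz
      have h2 : ∀ᶠ w in 𝓝 z, p w = 0 := by
        refine eventually_eq_of_eventually_eq_nhdsNE hp.continuousAt continuousAt_const ?_
        filter_upwards [h1, hq0.filter_mono nhdsWithin_le_nhds] with w hw hw'
        exact (div_eq_zero_iff.1 hw).resolve_right hw'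
      right
      filter_upwards [h2, hpq, hq0] with w hw hw' hw0
      rw [hw'.2, hw, projMk, if_neg hw0, zero_div]
  set χ : ℂ → ℂ := fun z => if u z = OnePoint.infty then 1 else 0 with hχ
  have hχd : ∀ z ∈ ball (0 : ℂ) 1, HasDerivAt χ 0 z := fun z hz => by
    rcases hloc z hz with h | h
    · refine (hasDerivAt_const z (1 : ℂ)).congr_of_eventuallyEq ?_
      filter_upwards [h] with w hw using if_pos hw
    · refine (hasDerivAt_const z (0 : ℂ)).congr_of_eventuallyEq ?_
      filter_upwards [h] with w hw using if_neg (by rw [hw]; exact OnePoint.coe_ne_infty _)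
  have hconst : ∀ z ∈ ball (0 : ℂ) 1, χ z = χ 0 := fun z hz => by
    have := (convex_ball (0 : ℂ) 1).norm_image_sub_le_of_norm_deriv_le (C := 0)
      (fun w hw => (hχd w hw).differentiableAt) (fun w hw => by rw [(hχd w hw).deriv, norm_zero])
      (mem_ball_self one_pos) hz
    rwa [zero_mul, norm_le_zero_iff, sub_eq_zero] at this
  by_cases h0 : u 0 = OnePoint.infty
  · left
    intro z hz
    by_contra hne
    have := hconst z hz
    simp [hχ, h0, hne] at this
  · right
    intro z hz
    rcases hloc z hz with h | h
    · have := hconst z hz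
      simp [hχ, h0, h.self_of_nhds] at this
    · exact h.self_of_nhds

lemma HolomorphicOnSphere.exists_isFrame_ball {u : ℂ → OnePoint ℂ}
    (hu : HolomorphicOnSphere u (ball 0 1)) {r : ℝ} (hr : r < 1) :
    ∃ M, IsFrame u M (ball 0 r) := by
  have hsub : ball (0 : ℂ) r ⊆ ball 0 1 := ball_subset_ball hr.le
  have hsubc : closedBall (0 : ℂ) r ⊆ ball 0 1 := closedBall_subset_ball hr
  have hv := hu.meromorphicOn_affineCoord
  by_cases htop : ∃ z ∈ ball (0 : ℂ) 1, meromorphicOrderAt (fun z => affineCoord (u z)) z ≠ ⊤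
  swap
  · push Not at htop
    rcases hu.eq_infty_or_eq_zero (fun z hz => meromorphicOrderAt_eq_top_iff.1 (htop z hz))
      with h | h
    · refine ⟨fun _ => ![![1, 0], ![0, 1]], fun i j => differentiableOn_const _,
        fun z _ => by simp, fun z hz => ?_⟩
      rw [h z (hsub hz)]
      exact (projMk_zero_right _).symm
    · refine ⟨fun _ => ![![0, -1], ![1, 0]], fun i j => differentiableOn_const _,
        fun z _ => by simp, fun z hz => ?_⟩
      rw [h z (hsub hz)]
      exact (projMk_one _).symm
  rw [hv.exists_meromorphicOrderAt_ne_top_iff_forall_mem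
    (Metric.isConnected_ball one_pos)] at htop
  have hvr : MeromorphicOn (fun z => affineCoord (u z)) (closedBall 0 r) := fun z hz =>
    hv z (hsubc hz)
  obtain ⟨g, hg, hg0, hgv⟩ := hvr.extract_zeros_poles (fun z => htop z (hsubc z.2))
    ((MeromorphicOn.divisor _ _).finiteSupport (isCompact_closedBall 0 r))
  obtain ⟨P, Q, ⟨x, y, hxy⟩, hQ0, hPQ⟩ := exists_coprime_polynomial_of_finite _
    ((MeromorphicOn.divisor (fun z => affineCoord (u z)) (closedBall 0 r)).finiteSupport
      (isCompact_closedBall 0 r))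
  have hbez : ∀ z : ℂ, x.eval z * P.eval z + y.eval z * Q.eval z = 1 := fun z => by
    rw [← Polynomial.eval_mul, ← Polynomial.eval_mul, ← Polynomial.eval_add, hxy,
      Polynomial.eval_one]
  have hgd : DifferentiableOn ℂ g (ball 0 r) := fun z hz =>
    (hg z (ball_subset_closedBall hz)).differentiableAt.differentiableWithinAt
  have hgne : ∀ z ∈ ball (0 : ℂ) r, g z ≠ 0 := fun z hz => hg0 ⟨z, ball_subset_closedBall hz⟩
  refine ⟨fun z => ![![P.eval z * g z, -y.eval z], ![Q.eval z, x.eval z / g z]],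
    fun i j => ?_, fun z hz => ?_, fun z hz => ?_⟩
  · fin_cases i <;> fin_cases j
    · exact P.differentiable.differentiableOn.mul hgd
    · exact y.differentiable.differentiableOn.neg
    · exact Q.differentiable.differentiableOn
    · exact x.differentiable.differentiableOn.div hgd hgne
  · have := hgne z hz
    simp only [Matrix.cons_val_zero, Matrix.cons_val_one]
    field_simp
    linear_combination hbez z
  · simp only [Matrix.cons_val_zero, Matrix.cons_val_one]
    obtain ⟨p, q, hp, hq, hpq⟩ := hu.exists_projMk (hsub hz)
    rw [hpq.self_of_nhds.2, projMk_eq_iff hpq.self_of_nhds.1]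
    · have hga := hg z (ball_subset_closedBall hz)
      refine eq_of_eventually_eq_nhdsNE (f := fun w => p w * Q.eval w)
        (g := fun w => P.eval w * g w * q w)
        (hp.continuousAt.mul Q.continuous.continuousAt)
        ((P.continuous.continuousAt.mul hga.continuousAt).mul hq.continuousAt) ?_
      have h1 := (mem_codiscreteWithin_iff_forall_mem_nhdsNE.1 hgv) z (ball_subset_closedBall hz)
      have hQe : ∀ᶠ w in 𝓝[≠] z, Q.eval w ≠ 0 := by
        have hfin : {w | w ≠ z ∧ Q.eval w = 0}.Finite :=
          Q.roots.toFinset.finite_toSet.subset fun w hw => by simpa [hQ0] using hw.2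
        have := hfin.isClosed.isOpen_compl.mem_nhds (x := z) (by simp)
        rw [eventually_nhdsWithin_iff]
        filter_upwards [this] with w hw hwz hw0
        exact hw ⟨hwz, hw0⟩
      have hqe : ∀ᶠ w in 𝓝[≠] z, q w ≠ 0 := by
        rcases hq.eventually_eq_zero_or_eventually_ne_zero with h | h
        · refine absurd (meromorphicOrderAt_eq_top_iff.2 ?_) (htop z (hsub hz))
          filter_upwards [(h.and hpq).filter_mono nhdsWithin_le_nhds] with w hw
          rw [hw.2.2, affineCoord_projMk, hw.1, div_zero]
        · exact h
      filter_upwards [h1, hQe, hqe, hpq.filter_mono nhdsWithin_le_nhds,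
        mem_nhdsWithin_of_mem_nhds (isOpen_ball.mem_nhds hz)] with w hw1 hwQ hwq hw hwb
      have h2 := hw1.resolve_right (fun h => h (ball_subset_closedBall hwb))
      have h3 : affineCoord (u w) = P.eval w / Q.eval w * g w := by
        rw [hPQ]; exact h2
      rw [hw.2, affineCoord_projMk] at h3
      field_simp at h3
      linear_combination h3
    · by_contra! h
      have h2 : P.eval z = 0 := (mul_eq_zero.1 h.1).resolve_right (hgne z hz)
      have := hbez z
      simp [h2, h.2] at this

end LocalFrames

section Gluing
open Filter Topology

lemma norm_exp_sub_exp_le {w w' : ℂ} {C η : ℝ} (hw : ‖w‖ ≤ C) (hη : ‖w' - w‖ ≤ η) (hη1 : η ≤ 1) :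
    ‖exp w' - exp w‖ ≤ Real.exp C * (2 * η) := by
  have h : exp w' - exp w = exp w * (exp (w' - w) - 1) := by
    rw [mul_sub, ← exp_add, mul_one]
    congr 2
    ring
  rw [h, norm_mul]
  have h1 := norm_exp_sub_one_le (hη.trans hη1)
  exact mul_le_mul (norm_exp_le_of_norm_le hw) (by linarith) (norm_nonneg _) (Real.exp_pos _).le

lemma exists_polynomial_approx_exp {φ β : ℂ → ℂ} {ρ R τ : ℝ} (hR : ρ < R)
    (hφ : DifferentiableOn ℂ φ (ball 0 R)) (hβ : DifferentiableOn ℂ β (ball 0 R)) (hτ : 0 < τ) :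
    ∃ P Q : Polynomial ℂ, ∀ z ∈ closedBall (0 : ℂ) ρ, ‖exp (P.eval z) - exp (φ z)‖ ≤ τ ∧
      ‖exp (-P.eval z) - exp (-φ z)‖ ≤ τ ∧ ‖Q.eval z - β z‖ ≤ τ := by
  obtain ⟨C, hC⟩ := (isCompact_closedBall (0 : ℂ) ρ).exists_bound_of_continuousOn
    (hφ.continuousOn.mono (closedBall_subset_ball hR))
  have hE := Real.exp_pos C
  set η := min 1 (τ / (2 * Real.exp C)) with hη
  have hη0 : 0 < η := lt_min one_pos (by positivity)
  have hητ : Real.exp C * (2 * η) ≤ τ := by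
    have := min_le_right 1 (τ / (2 * Real.exp C))
    rw [le_div_iff₀ (by positivity)] at this
    linarith
  obtain ⟨P, hP⟩ := exists_polynomial_approx hR hφ hη0
  obtain ⟨Q, hQ⟩ := exists_polynomial_approx hR hβ hτ
  refine ⟨P, Q, fun z hz => ⟨?_, ?_, ?_⟩⟩
  · exact (norm_exp_sub_exp_le (hC z hz) (by rw [norm_sub_rev]; exact hP z hz)
      (min_le_left _ _)).trans hητ
  · refine (norm_exp_sub_exp_le (C := C) (η := η) (by rw [norm_neg]; exact hC z hz) ?_
      (min_le_left _ _)).trans hητ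
    rw [neg_sub_neg]
    exact hP z hz
  · rw [norm_sub_rev]; exact hQ z hz

lemma IsFrame.exists_transition {u : ℂ → OnePoint ℂ} {M N : ℂ → Fin 2 → Fin 2 → ℂ} {r : ℝ}
    (hr : 0 < r) (hM : IsFrame u M (ball 0 r)) (hN : IsFrame u N (ball 0 r)) :
    ∃ φ β : ℂ → ℂ, DifferentiableOn ℂ φ (ball 0 r) ∧ DifferentiableOn ℂ β (ball 0 r) ∧
      ∀ z ∈ ball (0 : ℂ) r, ∀ i, M z i 0 = N z i 0 * exp (φ z) ∧
        M z i 1 = N z i 0 * β z + N z i 1 * exp (-φ z) := by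
  have hcol : ∀ z ∈ ball (0 : ℂ) r, M z 0 0 * N z 1 0 = N z 0 0 * M z 1 0 := fun z hz => by
    rw [← projMk_eq_iff (hM.ne_zero hz) (hN.ne_zero hz), ← hM.lift_eq z hz, ← hN.lift_eq z hz]
  have hdet : ∀ z ∈ ball (0 : ℂ) r, (N z 1 1 * M z 0 0 - N z 0 1 * M z 1 0) *
      (N z 0 0 * M z 1 1 - N z 1 0 * M z 0 1) = 1 := fun z hz => by
    have h1 := hM.det_eq_one z hz
    have h2 := hN.det_eq_one z hz
    have h3 := hcol z hz
    linear_combination (N z 0 0 * N z 1 1 - N z 0 1 * N z 1 0) * h1 + h2 +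
      (N z 0 1 * M z 1 1 - N z 1 1 * M z 0 1) * h3
  obtain ⟨φ, hφ, hφe⟩ := exists_log_lift (q := fun z => N z 1 1 * M z 0 0 - N z 0 1 * M z 1 0) hr
    (((hN.differentiableOn 1 1).mul (hM.differentiableOn 0 0)).sub
      ((hN.differentiableOn 0 1).mul (hM.differentiableOn 1 0)))
    (fun z hz h => by
      have := hdet z hz
      rw [h, zero_mul] at this
      exact zero_ne_one this)
  refine ⟨φ, fun z => N z 1 1 * M z 0 1 - N z 0 1 * M z 1 1, hφ,
    ((hN.differentiableOn 1 1).mul (hM.differentiableOn 0 1)).sub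
      ((hN.differentiableOn 0 1).mul (hM.differentiableOn 1 1)), fun z hz => ?_⟩
  have h1 := hM.det_eq_one z hz
  have h2 := hN.det_eq_one z hz
  have h3 := hcol z hz
  have h4 := hdet z hz
  have h5 : exp (-φ z) = N z 0 0 * M z 1 1 - N z 1 0 * M z 0 1 := by
    rw [exp_neg, ← hφe z hz]
    exact inv_eq_of_mul_eq_one_right h4
  rw [← hφe z hz, h5]
  intro i
  fin_cases i <;> simp only [Fin.zero_eta, Fin.mk_one, Fin.isValue]
  · exact ⟨by linear_combination -(M z 0 0) * h2 - N z 0 1 * h3,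
      by linear_combination -(M z 0 1) * h2⟩
  · exact ⟨by linear_combination -(M z 1 0) * h2 - N z 1 1 * h3,
      by linear_combination -(M z 1 1) * h2⟩

lemma IsFrame.exists_approx {u : ℂ → OnePoint ℂ} {M N : ℂ → Fin 2 → Fin 2 → ℂ} {ρ r R ε : ℝ}
    (hr : 0 < r) (hρ : ρ < r) (hrR : r ≤ R) (hM : IsFrame u M (ball 0 r))
    (hN : IsFrame u N (ball 0 R)) (hε : 0 < ε) :
    ∃ M', IsFrame u M' (ball 0 R) ∧
      ∀ z ∈ closedBall (0 : ℂ) ρ, ∀ i j, ‖M' z i j - M z i j‖ ≤ ε := by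
  have hsub : ball (0 : ℂ) r ⊆ ball 0 R := ball_subset_ball hrR
  have hρr : closedBall (0 : ℂ) ρ ⊆ ball 0 r := closedBall_subset_ball hρ
  obtain ⟨φ, β, hφ, hβ, hMN⟩ := hM.exists_transition hr (hN.mono hsub)
  have hcont : ContinuousOn N (closedBall 0 ρ) := continuousOn_pi.2 fun i => continuousOn_pi.2
    fun j => (hN.differentiableOn i j).continuousOn.mono (hρr.trans hsub)
  obtain ⟨K, hK⟩ := (isCompact_closedBall (0 : ℂ) ρ).exists_bound_of_continuousOn hcont
  have hKij : ∀ z ∈ closedBall (0 : ℂ) ρ, ∀ i j, ‖N z i j‖ ≤ |K| + 1 := fun z hz i j =>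
    ((norm_le_pi_norm (N z i) j).trans (norm_le_pi_norm (N z) i)).trans
      ((hK z hz).trans ((le_abs_self K).trans (by linarith)))
  have hτ : 0 < ε / (2 * (|K| + 1)) := by positivity
  obtain ⟨P, Q, hPQ⟩ := exists_polynomial_approx_exp hρ hφ hβ hτ
  have hP : Differentiable ℂ fun z => P.eval z := P.differentiable
  have hQ : Differentiable ℂ fun z => Q.eval z := Q.differentiable
  have hexp : ∀ z, exp (P.eval z) * exp (-P.eval z) = 1 := fun z => by
    rw [← exp_add, add_neg_cancel, exp_zero]
  refine ⟨fun z i => ![N z i 0 * exp (P.eval z), N z i 0 * Q.eval z + N z i 1 * exp (-P.eval z)],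
    ⟨fun i j => ?_, fun z hz => ?_, fun z hz => ?_⟩, fun z hz i j => ?_⟩
  · fin_cases j
    · exact (hN.differentiableOn i 0).mul hP.cexp.differentiableOn
    · exact ((hN.differentiableOn i 0).mul hQ.differentiableOn).add
        ((hN.differentiableOn i 1).mul hP.neg.cexp.differentiableOn)
  · simp only [Matrix.cons_val_zero, Matrix.cons_val_one]
    linear_combination exp (P.eval z) * exp (-P.eval z) * hN.det_eq_one z hz + hexp z
  · simp only [Matrix.cons_val_zero]
    rw [hN.lift_eq z hz, projMk_eq_iff (hN.ne_zero hz)]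
    · ring
    · simpa [exp_ne_zero] using hN.ne_zero hz
  · obtain ⟨h1, h2, h3⟩ := hPQ z hz
    obtain ⟨h4, h5⟩ := hMN z (hρr hz) i
    have hτK : (|K| + 1) * (ε / (2 * (|K| + 1))) = ε / 2 := by field_simp
    have hm : ∀ j, ∀ x : ℂ, ‖x‖ ≤ ε / (2 * (|K| + 1)) → ‖N z i j * x‖ ≤ ε / 2 := fun j x hx => by
      rw [norm_mul, ← hτK]
      exact mul_le_mul (hKij z hz i j) hx (norm_nonneg _) (by positivity)
    fin_cases j
    · simp only [Fin.zero_eta, Matrix.cons_val_zero]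
      rw [h4, ← mul_sub]
      linarith [hm 0 _ h1]
    · simp only [Fin.mk_one, Matrix.cons_val_one, Matrix.cons_val_zero]
      have h6 : N z i 0 * Q.eval z + N z i 1 * exp (-P.eval z) - M z i 1 =
          N z i 0 * (Q.eval z - β z) + N z i 1 * (exp (-P.eval z) - exp (-φ z)) := by
        rw [h5]; ring
      rw [h6]
      refine (norm_add_le _ _).trans ?_
      linarith [hm 0 _ h3, hm 1 _ h2]

lemma HolomorphicOnSphere.exists_isFrame {u : ℂ → OnePoint ℂ}
    (hu : HolomorphicOnSphere u (ball 0 1)) : ∃ M, IsFrame u M (ball 0 1) := by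
  obtain ⟨R, hRmono, hR, hRlim⟩ := exists_seq_strictMono_tendsto' (x := (1 : ℝ)) one_pos
  choose N hN using fun k => hu.exists_isFrame_ball (hR k).2
  have step : ∀ (k : ℕ) (M : ℂ → Fin 2 → Fin 2 → ℂ), IsFrame u M (ball 0 (R (k + 1))) →
      ∃ M', IsFrame u M' (ball 0 (R (k + 1 + 1))) ∧
        ∀ z ∈ closedBall (0 : ℂ) (R k), ∀ i j, ‖M' z i j - M z i j‖ ≤ 1 / 2 / 2 ^ k :=
    fun k M hM => hM.exists_approx (hR _).1 (hRmono (Nat.lt_succ_self k))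
      (hRmono (Nat.lt_succ_self _)).le (hN _) (by positivity)
  choose! F hF hFε using step
  let M : ℕ → ℂ → Fin 2 → Fin 2 → ℂ := fun k => Nat.rec (N 1) (fun k M => F k M) k
  have hM : ∀ k, IsFrame u (M k) (ball 0 (R (k + 1))) := fun k => by
    induction k with
    | zero => exact hN 1
    | succ k ih => exact hF k _ ih
  have hMε : ∀ k, ∀ z ∈ closedBall (0 : ℂ) (R k), ∀ i j,
      ‖M (k + 1) z i j - M k z i j‖ ≤ 1 / 2 / 2 ^ k := fun k => hFε k _ (hM k)
  have hgeom : ∀ k, ∀ z ∈ closedBall (0 : ℂ) (R k), ∀ i j n,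
      dist (M (n + k) z i j) (M (n + 1 + k) z i j) ≤ 1 / 2 ^ k / 2 / 2 ^ n :=
    fun k z hz i j n => by
      have h := hMε (n + k) z (closedBall_subset_closedBall
        (hRmono.monotone (Nat.le_add_left k n)) hz) i j
      rw [dist_comm, dist_eq_norm, show n + 1 + k = n + k + 1 by ring]
      refine h.trans (le_of_eq ?_)
      rw [pow_add]
      field_simp
  have hlarge : ∀ z ∈ ball (0 : ℂ) 1, ∃ k, z ∈ ball (0 : ℂ) (R k) := fun z hz => by
    rw [mem_ball] at hz
    exact (hRlim.eventually (lt_mem_nhds hz)).exists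
  have hex : ∀ z i j, ∃ y, z ∈ ball (0 : ℂ) 1 → Tendsto (fun k => M k z i j) atTop (𝓝 y) :=
    fun z i j => by
      by_cases hz : z ∈ ball (0 : ℂ) 1
      · obtain ⟨k, hk⟩ := hlarge z hz
        obtain ⟨y, hy⟩ := cauchySeq_tendsto_of_complete
          (cauchySeq_of_le_geometric_two (hgeom k z (ball_subset_closedBall hk) i j))
        exact ⟨y, fun _ => (tendsto_add_atTop_iff_nat k).1 hy⟩
      · exact ⟨0, fun h => absurd h hz⟩
  choose L hL using hex
  have hLε : ∀ k, ∀ z ∈ closedBall (0 : ℂ) (R k), ∀ i j,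
      dist (L z i j) (M k z i j) ≤ 1 / 2 ^ k := fun k z hz i j => by
    have h := dist_le_of_le_geometric_two_of_tendsto₀ (hgeom k z hz i j)
      ((tendsto_add_atTop_iff_nat k).2 (hL z i j (closedBall_subset_ball (hR k).2 hz)))
    rwa [zero_add, dist_comm] at h
  have hunif : ∀ i j, TendstoLocallyUniformlyOn (fun k z => M k z i j) (fun z => L z i j)
      atTop (ball 0 1) := fun i j => by
    rw [Metric.tendstoLocallyUniformlyOn_iff]
    intro ε hε z hz
    obtain ⟨k, hk⟩ := hlarge z hz
    refine ⟨ball 0 (R k), mem_nhdsWithin_of_mem_nhds (isOpen_ball.mem_nhds hk), ?_⟩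
    have hpow : Tendsto (fun n : ℕ => 1 / (2 : ℝ) ^ n) atTop (𝓝 0) := by
      simpa using tendsto_pow_atTop_nhds_zero_of_lt_one (r := (1 / 2 : ℝ)) (by norm_num)
        (by norm_num)
    filter_upwards [eventually_ge_atTop k, hpow.eventually (gt_mem_nhds hε)] with n hn hnε y hy
    exact (hLε n y (closedBall_subset_closedBall (hRmono.monotone hn)
      (ball_subset_closedBall hy)) i j).trans_lt hnε
  have hmem : ∀ z ∈ ball (0 : ℂ) 1, ∀ᶠ k in atTop, z ∈ ball (0 : ℂ) (R (k + 1)) := fun z hz => by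
    rw [mem_ball] at hz
    exact ((tendsto_add_atTop_iff_nat 1).2 hRlim).eventually (lt_mem_nhds hz)
  have hdet : ∀ z ∈ ball (0 : ℂ) 1, L z 0 0 * L z 1 1 - L z 0 1 * L z 1 0 = 1 := fun z hz => by
    refine tendsto_nhds_unique_of_eventuallyEq (((hL z 0 0 hz).mul (hL z 1 1 hz)).sub
      ((hL z 0 1 hz).mul (hL z 1 0 hz))) tendsto_const_nhds ?_
    filter_upwards [hmem z hz] with k hk using (hM k).det_eq_one z hk
  refine ⟨L, fun i j => differentiableOn_ball_of_tendsto (hunif i j) fun r hr => ?_, hdet,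
    fun z hz => ?_⟩
  · filter_upwards [((tendsto_add_atTop_iff_nat 1).2 hRlim).eventually (lt_mem_nhds hr)]
      with k hk using ((hM k).differentiableOn i j).mono (ball_subset_ball hk.le)
  · obtain ⟨p, q, hpq, hupq⟩ := exists_projMk_eq (u z)
    rw [hupq, projMk_eq_iff hpq]
    · refine tendsto_nhds_unique_of_eventuallyEq ((hL z 1 0 hz).const_mul p)
        ((hL z 0 0 hz).mul_const q) ?_
      filter_upwards [hmem z hz] with k hk
      rw [← projMk_eq_iff hpq ((hM k).ne_zero hk), ← hupq, (hM k).lift_eq z hk]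
    · by_contra! h
      have := hdet z hz
      simp [h.1, h.2] at this

end Gluing

section SphereMotions
open Filter Topology

lemma moebius_ne_zero {a b c d : ℂ} (h : a * d - b * c = 1) (w : ℂ) :
    a * w + b ≠ 0 ∨ c * w + d ≠ 0 := by
  by_contra! h0
  exact one_ne_zero (by linear_combination a * h0.2 - c * h0.1 - h : (1 : ℂ) = 0)

lemma projMk_moebius_inj {a b c d : ℂ} (h : a * d - b * c = 1) {w w' : ℂ} :
    projMk (a * w + b) (c * w + d) = projMk (a * w' + b) (c * w' + d) ↔ w = w' := by
  rw [projMk_eq_iff (moebius_ne_zero h w) (moebius_ne_zero h w')]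
  refine ⟨fun e => ?_, fun e => by rw [e]⟩
  linear_combination e - (w - w') * h

lemma projMk_moebius_ne {a b c d : ℂ} (h : a * d - b * c = 1) (w : ℂ) :
    projMk (a * w + b) (c * w + d) ≠ projMk a c := by
  have hac : a ≠ 0 ∨ c ≠ 0 := by
    by_contra! h0
    simp [h0.1, h0.2] at h
  rw [Ne, projMk_eq_iff (moebius_ne_zero h w) hac]
  intro e
  exact one_ne_zero (by linear_combination -e - h : (1 : ℂ) = 0)

lemma projMk_eq_moebius {a b c d : ℂ} (h : a * d - b * c = 1) {p q : ℂ} (hpq : p ≠ 0 ∨ q ≠ 0)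
    (hne : a * q - c * p ≠ 0) :
    projMk p q = projMk (a * ((d * p - b * q) / (a * q - c * p)) + b)
      (c * ((d * p - b * q) / (a * q - c * p)) + d) := by
  rw [projMk_eq_iff hpq (moebius_ne_zero h _)]
  have e := div_mul_cancel₀ (d * p - b * q) hne
  generalize (d * p - b * q) / (a * q - c * p) = w at e ⊢
  linear_combination -e

lemma exists_eq_projMk_moebius {a b c d : ℂ} (h : a * d - b * c = 1) {x : OnePoint ℂ}
    (hx : x ≠ projMk a c) : ∃ w, x = projMk (a * w + b) (c * w + d) := by
  obtain ⟨p, q, hpq, rfl⟩ := exists_projMk_eq x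
  have hac : a ≠ 0 ∨ c ≠ 0 := by
    by_contra! h0
    simp [h0.1, h0.2] at h
  refine ⟨_, projMk_eq_moebius h hpq fun e => hx ?_⟩
  rw [projMk_eq_iff hpq hac]
  linear_combination -e

lemma IsFrame.exists_affine {u v : ℂ → OnePoint ℂ} {M : ℂ → Fin 2 → Fin 2 → ℂ} {s : Set ℂ}
    (hs : IsOpen s) (hM : IsFrame u M s) (hv : HolomorphicOnSphere v s)
    (hne : ∀ z ∈ s, v z ≠ u z) :
    ∃ w : ℂ → ℂ, DifferentiableOn ℂ w s ∧
      ∀ z ∈ s, v z = projMk (M z 0 0 * w z + M z 0 1) (M z 1 0 * w z + M z 1 1) := by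
  have hex : ∀ z, ∃ w, z ∈ s →
      v z = projMk (M z 0 0 * w + M z 0 1) (M z 1 0 * w + M z 1 1) := fun z => by
    by_cases hz : z ∈ s
    · obtain ⟨w, hw⟩ := exists_eq_projMk_moebius (hM.det_eq_one z hz)
        (by rw [← hM.lift_eq z hz]; exact hne z hz)
      exact ⟨w, fun _ => hw⟩
    · exact ⟨0, fun h => absurd h hz⟩
  choose w hw using hex
  refine ⟨w, fun z hz => ?_, hw⟩
  obtain ⟨p, q, hp, hq, hpq⟩ := hv.exists_projMk hz
  have hnum : ∀ z ∈ s, ∀ p q : ℂ, (p ≠ 0 ∨ q ≠ 0) → v z = projMk p q →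
      M z 0 0 * q - M z 1 0 * p ≠ 0 := fun z hz p q h1 h2 e => by
    refine hne z hz ?_
    rw [h2, hM.lift_eq z hz, projMk_eq_iff h1 (hM.ne_zero hz)]
    linear_combination -e
  have hd : ∀ i j, DifferentiableAt ℂ (fun z => M z i j) z := fun i j =>
    (hM.differentiableOn i j).differentiableAt (hs.mem_nhds hz)
  have hF : DifferentiableAt ℂ (fun z => (M z 1 1 * p z - M z 0 1 * q z) /
      (M z 0 0 * q z - M z 1 0 * p z)) z :=
    (((hd 1 1).mul hp.differentiableAt).sub ((hd 0 1).mul hq.differentiableAt)).div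
      (((hd 0 0).mul hq.differentiableAt).sub ((hd 1 0).mul hp.differentiableAt))
      (hnum z hz _ _ hpq.self_of_nhds.1 hpq.self_of_nhds.2)
  refine (hF.congr_of_eventuallyEq ?_).differentiableWithinAt
  filter_upwards [hpq, hs.mem_nhds hz] with y hy hys
  rw [← projMk_moebius_inj (hM.det_eq_one y hys), ← hw y hys, hy.2]
  exact projMk_eq_moebius (hM.det_eq_one y hys) hy.1 (hnum y hys _ _ hy.1 hy.2)

lemma IsFrame.holomorphicOnSphere {u : ℂ → OnePoint ℂ} {M : ℂ → Fin 2 → Fin 2 → ℂ} {s : Set ℂ}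
    (hs : IsOpen s) (hM : IsFrame u M s) {w : ℂ → ℂ} (hw : DifferentiableOn ℂ w s) :
    HolomorphicOnSphere
      (fun z => projMk (M z 0 0 * w z + M z 0 1) (M z 1 0 * w z + M z 1 1)) s :=
  holomorphicOnSphere_of_projMk fun z hz =>
    ⟨_, _, (((hM.differentiableOn 0 0).mul hw).add (hM.differentiableOn 0 1)).analyticAt
        (hs.mem_nhds hz),
      (((hM.differentiableOn 1 0).mul hw).add (hM.differentiableOn 1 1)).analyticAt
        (hs.mem_nhds hz), moebius_ne_zero (hM.det_eq_one z hz) _, Eventually.of_forall fun _ => rfl⟩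

lemma holomorphicOnSphere_const (x : OnePoint ℂ) (s : Set ℂ) :
    HolomorphicOnSphere (fun _ => x) s := by
  obtain ⟨p, q, h, rfl⟩ := exists_projMk_eq x
  exact holomorphicOnSphere_of_projMk fun z _ =>
    ⟨fun _ => p, fun _ => q, analyticAt_const, analyticAt_const, h,
      Eventually.of_forall fun _ => rfl⟩

lemma exists_avoiding_onSphere {ι : Type*} [Finite ι] {u : ι → ℂ → OnePoint ℂ}
    (hu : ∀ i, HolomorphicOnSphere (u i) (ball 0 1))
    (hne : ∀ i j, i ≠ j → ∀ z ∈ ball (0 : ℂ) 1, u i z ≠ u j z)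
    {x : OnePoint ℂ} (hx : ∀ i, x ≠ u i 0) :
    ∃ g : ℂ → OnePoint ℂ, HolomorphicOnSphere g (ball 0 1) ∧ g 0 = x ∧
      ∀ z ∈ ball (0 : ℂ) 1, ∀ i, g z ≠ u i z := by
  have hb0 : (0 : ℂ) ∈ ball (0 : ℂ) 1 := mem_ball_self one_pos
  rcases isEmpty_or_nonempty ι with he | ⟨⟨i₀⟩⟩
  · exact ⟨fun _ => x, holomorphicOnSphere_const x _, rfl, fun _ _ i => he.elim i⟩
  obtain ⟨M, hM⟩ := (hu i₀).exists_isFrame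
  choose w hw hwu using fun i : {i // i ≠ i₀} =>
    hM.exists_affine isOpen_ball (hu i) (hne i i₀ i.2)
  obtain ⟨w₀, hw₀⟩ := exists_eq_projMk_moebius (hM.det_eq_one 0 hb0)
    (by rw [← hM.lift_eq 0 hb0]; exact hx i₀)
  obtain ⟨g, hg, hg0, hgw⟩ := exists_avoiding hw
    (fun i j hij z hz e => hne i j (Subtype.coe_injective.ne hij) z hz (by
      rw [hwu i z hz, hwu j z hz, e])) (z₀ := w₀)
    (fun i e => hx i (by rw [hwu i 0 hb0, ← e, hw₀]))
  refine ⟨_, hM.holomorphicOnSphere isOpen_ball hg, by rw [hg0, hw₀], fun z hz i => ?_⟩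
  by_cases hi : i = i₀
  · rw [hi, hM.lift_eq z hz]
    exact projMk_moebius_ne (hM.det_eq_one z hz) _
  · rw [hwu ⟨i, hi⟩ z hz, Ne, projMk_moebius_inj (hM.det_eq_one z hz)]
    exact hgw z hz ⟨i, hi⟩

end SphereMotions

/-- **The finite λ-lemma.** A holomorphic motion of `n` pairwise distinct points
`a₁, …, aₙ` of `ℂ̂` extends to a holomorphic motion of `n+1` pairwise distinct points
`a₁, …, aₙ₊₁`. -/
theorem finite_lambda_lemma (n : ℕ) (a : Fin (n + 1) → OnePoint ℂ)
    (ha : Function.Injective a) (f : ℂ → OnePoint ℂ → OnePoint ℂ)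
    (hf : IsHolomorphicMotion (Set.range fun i : Fin n => a i.castSucc) f) :
    ∃ g : ℂ → OnePoint ℂ → OnePoint ℂ, IsHolomorphicMotion (Set.range a) g ∧
      ∀ l ∈ ball (0 : ℂ) 1, ∀ i : Fin n, g l (a i.castSucc) = f l (a i.castSucc) := by
  classical
  obtain ⟨hf1, hf2, hf3⟩ := hf
  have hlast : ∀ i : Fin n, a i.castSucc ≠ a (Fin.last n) := fun i =>
    ha.ne (Fin.castSucc_lt_last i).ne
  obtain ⟨G, hG, hG0, hGf⟩ := exists_avoiding_onSphere
    (u := fun (i : Fin n) l => f l (a i.castSucc)) (x := a (Fin.last n))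
    (fun i => hf1 _ ⟨i, rfl⟩)
    (fun i j hij z hz e => hij (Fin.castSucc_injective n
      (ha (hf2 z hz ⟨i, rfl⟩ ⟨j, rfl⟩ e))))
    (fun i => by rw [hf3 _ ⟨i, rfl⟩]; exact (hlast i).symm)
  have hold : ∀ l (i : Fin n), Function.update (f l) (a (Fin.last n)) (G l) (a i.castSucc) =
      f l (a i.castSucc) := fun l i => Function.update_of_ne (hlast i) _ _
  have hnew : ∀ l, Function.update (f l) (a (Fin.last n)) (G l) (a (Fin.last n)) = G l :=
    fun l => Function.update_self _ _ _
  refine ⟨fun l => Function.update (f l) (a (Fin.last n)) (G l), ⟨?_, ?_, ?_⟩,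
    fun l _ i => hold l i⟩
  · rintro _ ⟨i, rfl⟩
    induction i using Fin.lastCases with
    | last => simpa only [hnew] using hG
    | cast i => simpa only [hold] using hf1 _ ⟨i, rfl⟩
  · rintro l hl _ ⟨i, rfl⟩ _ ⟨j, rfl⟩ e
    induction i using Fin.lastCases with
    | last =>
      induction j using Fin.lastCases with
      | last => rfl
      | cast j =>
        beta_reduce at e
        rw [hnew, hold] at e
        exact (hGf l hl j e).elim
    | cast i =>
      induction j using Fin.lastCases with
      | last =>
        beta_reduce at e
        rw [hnew, hold] at e
        exact (hGf l hl i e.symm).elim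
      | cast j =>
        beta_reduce at e
        rw [hold, hold] at e
        exact hf2 l hl ⟨i, rfl⟩ ⟨j, rfl⟩ e
  · rintro _ ⟨i, rfl⟩
    induction i using Fin.lastCases with
    | last => simpa only [hnew] using hG0
    | cast i => simpa only [hold] using hf3 _ ⟨i, rfl⟩
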